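/- The number of edge-magic total labelings of the path P_12 (the path with 13 vertices and 12 edges), counted up to the reversal symmetry of the path, is 37898776. -/

import Mathlib

/-- The path `P n` has vertices `0,…,n` and edges `{j,j+1}` for `0 ≤ j < n`, a total of
`2n+1` graph elements, encoded as `Fin (2n+1)` with vertex `j` at index `2j` and edge
`{j,j+1}` at index `2j+1`.  An edge-magic total labeling is a bijection from these
elements to `{1,…,2n+1}` (encoded as a permutation `σ` of `Fin (2n+1)`, the label of
element `x` being `(σ x).val + 1`) such that every edge weight
`λ(u) + λ({u,v}) + λ(v)` equals a common constant `k`.  This counts such labelings up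
to the reversal symmetry of the path, i.e. those with `λ(vertex 0) < λ(vertex n)`. -/
noncomputable def pathEMTLCountUpToRev (n : ℕ) : ℕ := by
  classical
  exact (Finset.univ.filter (fun σ : Equiv.Perm (Fin (2 * n + 1)) =>
    (∃ k : ℕ, ∀ i : Fin n,
      ((σ ⟨2 * i.1, by have := i.isLt; omega⟩).val + 1) +
      ((σ ⟨2 * i.1 + 1, by have := i.isLt; omega⟩).val + 1) +
      ((σ ⟨2 * i.1 + 2, by have := i.isLt; omega⟩).val + 1) = k) ∧
    (σ ⟨0, by omega⟩).val < (σ ⟨2 * n, by omega⟩).val)).card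

set_option linter.unusedVariables false
namespace EM
/-! ### Kernel-friendly tables -/

inductive L | z | lf (N : Nat)
inductive N8 (α : Type) | z | n (a0 a1 a2 a3 a4 a5 a6 a7 : α)

noncomputable section
def rep (c : Nat) (g : Nat → Bool) (k : Nat) : Nat :=
  Nat.rec (motive := fun _ => Nat) c
    (fun i ih => Bool.rec (motive := fun _ => Nat)
      (Nat.add ih (Nat.shiftLeft ih (Nat.mul 8 (Nat.pow 2 i)))) ih (g i)) k
def msk (e : Nat) : Nat := rep 255 (fun i => Nat.beq i e) 15
def cst (c : Nat) : Nat := rep c (fun _ => false) 15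
def step (s : Nat) (l : List Nat) : Nat → List Nat :=
  List.rec (motive := fun _ => Nat → List Nat) (fun c => [c])
    (fun a _ ih c => Nat.add a c :: ih (Nat.shiftLeft a s)) l
def rows (k : Nat) : List Nat :=
  Nat.rec (motive := fun _ => List Nat) [255]
    (fun i ih => step (Nat.mul 8 (Nat.pow 2 i)) ih 0) k
def nth (l : List Nat) : Nat → Nat :=
  List.rec (motive := fun _ => Nat → Nat) (fun _ => 0)
    (fun a _ ih i => Nat.rec (motive := fun _ => Nat) a (fun i _ => ih i) i) l
def PM (q : Nat) : Nat := nth (rows 15) q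

def addL1 (t : L) (N : Nat) (u : L) : L :=
  L.rec (motive := fun _ => L) t (fun N' => .lf (Nat.add N N')) u
def addL (t u : L) : L := L.rec (motive := fun _ => L) u (fun N => addL1 t N u) t
def addIL1 (N : Nat) (u : L) : L :=
  L.rec (motive := fun _ => L) (.lf N) (fun N' => .lf (Nat.add N N')) u
def addIL (M s : Nat) (t u : L) : L :=
  L.rec (motive := fun _ => L) u (fun N => addIL1 (Nat.shiftLeft (Nat.land N M) s) u) t
def addML (p c : Nat) (t u : L) : L :=
  Bool.rec (motive := fun _ => L) u
    (L.rec (motive := fun _ => L) u (fun N => addIL1 (Nat.land N (PM (Nat.sub p c))) u) t)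
    (Nat.ble c p)

def add2 (α : Type) (f : α → α → α) (a0 a1 a2 a3 a4 a5 a6 a7 b0 b1 b2 b3 b4 b5 b6 b7 : α) : N8 α :=
  .n (f a0 b0) (f a1 b1) (f a2 b2) (f a3 b3) (f a4 b4) (f a5 b5) (f a6 b6) (f a7 b7)
def add1 (α : Type) (f : α → α → α) (t u : N8 α) (a0 a1 a2 a3 a4 a5 a6 a7 : α) : N8 α :=
  N8.rec (α := α) (motive := fun _ => N8 α)
    (t)
    (add2 α f a0 a1 a2 a3 a4 a5 a6 a7) u
def add (α : Type) (f : α → α → α) (t u : N8 α) : N8 α :=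
  N8.rec (α := α) (motive := fun _ => N8 α)
    (u)
    (add1 α f t u) t
def addz1 (α : Type) (f : α → α → α) (zz : α) (u : N8 α) (a0 a1 a2 a3 a4 a5 a6 a7 : α) : N8 α :=
  N8.rec (α := α) (motive := fun _ => N8 α)
    (.n (f a0 zz) (f a1 zz) (f a2 zz) (f a3 zz) (f a4 zz) (f a5 zz) (f a6 zz) (f a7 zz))
    (add2 α f a0 a1 a2 a3 a4 a5 a6 a7) u
def addz (α : Type) (f : α → α → α) (zz : α) (t u : N8 α) : N8 α :=
  N8.rec (α := α) (motive := fun _ => N8 α)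
    (u)
    (addz1 α f zz u) t
def addc1 (α : Type) (f : Nat → α → α → α) (c : Nat) (zz : α) (u : N8 α) (a0 a1 a2 a3 a4 a5 a6 a7 : α) : N8 α :=
  N8.rec (α := α) (motive := fun _ => N8 α)
    (.n (f (Nat.add c 0) a0 zz) (f (Nat.add c 1) a1 zz) (f (Nat.add c 1) a2 zz) (f (Nat.add c 2) a3 zz) (f (Nat.add c 1) a4 zz) (f (Nat.add c 2) a5 zz) (f (Nat.add c 2) a6 zz) (f (Nat.add c 3) a7 zz))
    (fun b0 b1 b2 b3 b4 b5 b6 b7 => .n (f (Nat.add c 0) a0 b0) (f (Nat.add c 1) a1 b1) (f (Nat.add c 1) a2 b2) (f (Nat.add c 2) a3 b3) (f (Nat.add c 1) a4 b4) (f (Nat.add c 2) a5 b5) (f (Nat.add c 2) a6 b6) (f (Nat.add c 3) a7 b7)) u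
def addc (α : Type) (f : Nat → α → α → α) (c : Nat) (zz : α) (t u : N8 α) : N8 α :=
  N8.rec (α := α) (motive := fun _ => N8 α)
    (u)
    (addc1 α f c zz u) t
def ins02 (α : Type) (f : α → α → α) (a0 a1 a2 a3 a4 a5 a6 a7 b0 b1 b2 b3 b4 b5 b6 b7 : α) : N8 α :=
  .n b0 b1 b2 b3 (f a0 b4) (f a1 b5) (f a2 b6) (f a3 b7)
def ins01 (α : Type) (f : α → α → α) (zz : α) (u : N8 α) (a0 a1 a2 a3 a4 a5 a6 a7 : α) : N8 α :=
  N8.rec (α := α) (motive := fun _ => N8 α)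
    (.n zz zz zz zz a0 a1 a2 a3)
    (ins02 α f a0 a1 a2 a3 a4 a5 a6 a7) u
def ins0 (α : Type) (f : α → α → α) (zz : α) (t u : N8 α) : N8 α :=
  N8.rec (α := α) (motive := fun _ => N8 α)
    (u)
    (ins01 α f zz u) t
def ins12 (α : Type) (f : α → α → α) (a0 a1 a2 a3 a4 a5 a6 a7 b0 b1 b2 b3 b4 b5 b6 b7 : α) : N8 α :=
  .n b0 b1 (f a0 b2) (f a1 b3) b4 b5 (f a4 b6) (f a5 b7)
def ins11 (α : Type) (f : α → α → α) (zz : α) (u : N8 α) (a0 a1 a2 a3 a4 a5 a6 a7 : α) : N8 α :=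
  N8.rec (α := α) (motive := fun _ => N8 α)
    (.n zz zz a0 a1 zz zz a4 a5)
    (ins12 α f a0 a1 a2 a3 a4 a5 a6 a7) u
def ins1 (α : Type) (f : α → α → α) (zz : α) (t u : N8 α) : N8 α :=
  N8.rec (α := α) (motive := fun _ => N8 α)
    (u)
    (ins11 α f zz u) t
def ins22 (α : Type) (f : α → α → α) (a0 a1 a2 a3 a4 a5 a6 a7 b0 b1 b2 b3 b4 b5 b6 b7 : α) : N8 α :=
  .n b0 (f a0 b1) b2 (f a2 b3) b4 (f a4 b5) b6 (f a6 b7)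
def ins21 (α : Type) (f : α → α → α) (zz : α) (u : N8 α) (a0 a1 a2 a3 a4 a5 a6 a7 : α) : N8 α :=
  N8.rec (α := α) (motive := fun _ => N8 α)
    (.n zz a0 zz a2 zz a4 zz a6)
    (ins22 α f a0 a1 a2 a3 a4 a5 a6 a7) u
def ins2 (α : Type) (f : α → α → α) (zz : α) (t u : N8 α) : N8 α :=
  N8.rec (α := α) (motive := fun _ => N8 α)
    (u)
    (ins21 α f zz u) t

def insN (α : Type) (f : α → α → α) (zz : α) (g : Nat → N8 α → N8 α → N8 α) (q : Nat) :
    N8 α → N8 α → N8 α :=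
  Nat.rec (motive := fun _ => N8 α → N8 α → N8 α) (ins0 α f zz)
    (fun q _ => Nat.rec (motive := fun _ => N8 α → N8 α → N8 α) (ins1 α f zz)
      (fun q _ => Nat.rec (motive := fun _ => N8 α → N8 α → N8 α) (ins2 α f zz)
        (fun q _ => g q) q) q) q

abbrev T1 : Type := N8 L
abbrev T2 : Type := N8 T1
abbrev T3 : Type := N8 T2
def A1 : T1 → T1 → T1 := add L addL
def A2 : T2 → T2 → T2 := add T1 A1
def I1 (M s : Nat) : T1 → T1 → T1 := addz L (addIL M s) .z
def I2 (M s : Nat) : T2 → T2 → T2 := addz T1 (I1 M s) .z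
def I3 (M s : Nat) : T3 → T3 → T3 := addz T2 (I2 M s) .z
def M1 (p c : Nat) : T1 → T1 → T1 := addc L (addML p) c .z
def M2 (p c : Nat) : T2 → T2 → T2 := addc T1 (M1 p) c .z
def M3 (p c : Nat) : T3 → T3 → T3 := addc T2 (M2 p) c .z
def E1 (q : Nat) : T1 → T1 → T1 := insN L addL .z (fun _ _ u => u) q
def E2 (q : Nat) : T2 → T2 → T2 := insN T1 A1 .z (fun q => addz T1 (E1 q) .z) q
def E3 (q : Nat) : T3 → T3 → T3 := insN T2 A2 .z (fun q => addz T2 (E2 q) .z) q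
/-- `addE p e t u`: the table `u` plus `t` with the label `e` inserted everywhere; `p` is the
cardinality of the sets of `t`. -/
def addE (p e : Nat) : T3 → T3 → T3 :=
  Bool.rec (motive := fun _ => T3 → T3 → T3) (E3 (Nat.sub 24 e))
    (Nat.rec (motive := fun _ => T3 → T3 → T3) (M3 p 0)
      (fun e _ => I3 (msk e) (Nat.mul 8 (Nat.pow 2 e))) e) (Nat.ble e 15)

def and' (a b : Bool) : Bool := Bool.rec (motive := fun _ => Bool) false b a
def isz0 (t : L) : Bool := L.rec (motive := fun _ => Bool) true (fun _ => false) t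
def isz (α : Type) (t : N8 α) : Bool :=
  N8.rec (α := α) (motive := fun _ => Bool)
    (true)
    (fun _ _ _ _ _ _ _ _ => false) t
def nm0 (t : L) : L :=
  L.rec (motive := fun _ => L) .z
    (fun N => Bool.rec (motive := fun _ => L) (.lf N) .z (Nat.beq N 0)) t
def nm1 (α : Type) (iz : α → Bool) (a0 a1 a2 a3 a4 a5 a6 a7 : α) : N8 α :=
  Bool.rec (motive := fun _ => N8 α) (.n a0 a1 a2 a3 a4 a5 a6 a7) .z
    (and' (iz a0) (and' (iz a1) (and' (iz a2) (and' (iz a3) (and' (iz a4) (and' (iz a5) (and' (iz a6) (iz a7))))))))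
def nm (α : Type) (iz : α → Bool) (f : α → α) (t : N8 α) : N8 α :=
  N8.rec (α := α) (motive := fun _ => N8 α)
    (.z)
    (fun a0 a1 a2 a3 a4 a5 a6 a7 => nm1 α iz (f a0) (f a1) (f a2) (f a3) (f a4) (f a5) (f a6) (f a7)) t
def norm : T3 → T3 := nm T2 (isz T1) (nm T1 (isz L) (nm L isz0 nm0))
def c5 : Nat := cst 5
def c240 : Nat := cst 240
def ck0 (t : L) : Bool :=
  L.rec (motive := fun _ => Bool) true
    (fun N => Nat.beq (Nat.land (Nat.add N c5) c240) 0) t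
def ck (α : Type) (f : α → Bool) (t : N8 α) : Bool :=
  N8.rec (α := α) (motive := fun _ => Bool)
    (true)
    (fun a0 a1 a2 a3 a4 a5 a6 a7 => and' (f a0) (and' (f a1) (and' (f a2) (and' (f a3) (and' (f a4) (and' (f a5) (and' (f a6) (f a7)))))))) t
def chk : T3 → Bool := ck T2 (ck T1 (ck L ck0))
def chkL (G : List T3) : Bool :=
  List.rec (motive := fun _ => Bool) true (fun t _ ih => and' (chk t) ih) G
def sumU (tst : Nat → Nat → Bool) (p s : Nat) (G : List T3) : Nat → T3 :=
  List.rec (motive := fun _ => Nat → T3) (fun _ => .z)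
    (fun t _ ih x => Bool.rec (motive := fun _ => T3) (ih (Nat.succ x))
      (addE p (Nat.sub s x) t (ih (Nat.succ x))) (and' (Nat.ble x s) (tst (Nat.sub s x) x))) G
def mkG (tst : Nat → Nat → Bool) (p K : Nat) (G : List T3) (l : List Nat) : List T3 :=
  List.rec (motive := fun _ => List T3) []
    (fun v _ ih => norm (addE (Nat.add p 1) v (sumU tst p (Nat.sub K v) G 0) .z) :: ih) l
def unit : T3 := .n (.n (.n (.lf 1) .z .z .z .z .z .z .z) .z .z .z .z .z .z .z)
  .z .z .z .z .z .z .z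
def vs : List Nat := [0,1,2,3,4,5,6,7,8,9,10,11,12,13,14,15,16,17,18,19,20,21,22,23,24]
def G0 (l : List Nat) : List T3 :=
  List.rec (motive := fun _ => List T3) [] (fun v _ ih => addE 0 v unit .z :: ih) l
def t0 (e x : Nat) : Bool := Nat.blt e x
def t1 (e _ : Nat) : Bool := Nat.ble e 24

def R0 : Nat := Nat.mul 255 (Nat.div (Nat.sub (Nat.pow 256 2049) 1) 16777215)
def R1 : Nat := Nat.mul 65280 (Nat.div (Nat.sub (Nat.pow 256 2049) 1) 16777215)
def R2 : Nat := Nat.mul 16711680 (Nat.div (Nat.sub (Nat.pow 256 2049) 1) 16777215)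
def c192 : Nat := cst 192
def dl2 (a b : Nat) : Nat :=
  Nat.mod (Nat.shiftRight (Nat.add (Nat.mul (Nat.land a R0) (Nat.land b R1))
    (Nat.add (Nat.mul (Nat.land a R1) (Nat.land b R0)) (Nat.mul (Nat.land a R2) (Nat.land b R2))))
      16376) 16777216
def dlz (s a b : Nat) : Nat :=
  Bool.rec (motive := fun _ => Nat)
    (Bool.rec (motive := fun _ => Nat) (Nat.add (dl2 a b) s) s (Nat.beq b 0)) s (Nat.beq a 0)
def dlr (d : Nat) : Nat → Nat → Nat → Nat :=
  Nat.rec (motive := fun _ => Nat → Nat → Nat → Nat) dlz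
    (fun d ih s a b =>
      ih (ih s (Nat.land a (Nat.sub (Nat.pow 2 (Nat.mul 16384 (Nat.pow 2 d))) 1))
          (Nat.shiftRight b (Nat.mul 16384 (Nat.pow 2 d))))
        (Nat.shiftRight a (Nat.mul 16384 (Nat.pow 2 d)))
        (Nat.land b (Nat.sub (Nat.pow 2 (Nat.mul 16384 (Nat.pow 2 d))) 1))) d
def dlspec (a b : Nat) : Nat :=
  ∑ i ∈ Finset.range 32768, (a / 256 ^ i % 256) * (b / 256 ^ (32767 - i) % 256)
def dl (s a b : Nat) : Nat :=
  Bool.rec (motive := fun _ => Nat) (Nat.add s (dlspec a b)) (dlr 4 s a b)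
    (Nat.beq (Nat.land (Nat.lor a b) c192) 0)
def dot0 (s : Nat) (t u : L) : Nat :=
  L.rec (motive := fun _ => Nat) s
    (fun N => L.rec (motive := fun _ => Nat) s (fun M => dl s N M) u) t
def dotN1 (α : Type) (f : Nat → α → α → Nat) (s : Nat) (u : N8 α) (a0 a1 a2 a3 a4 a5 a6 a7 : α) : Nat :=
  N8.rec (α := α) (motive := fun _ => Nat)
    (s)
    (fun b0 b1 b2 b3 b4 b5 b6 b7 => f (f (f (f (f (f (f (f (s) a0 b7) a1 b6) a2 b5) a3 b4) a4 b3) a5 b2) a6 b1) a7 b0) u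
def dotN (α : Type) (f : Nat → α → α → Nat) (s : Nat) (t u : N8 α) : Nat :=
  N8.rec (α := α) (motive := fun _ => Nat)
    (s)
    (dotN1 α f s u) t
def dotH1 (α : Type) (f : Nat → α → α → Nat) (s : Nat) (u : N8 α) (a0 a1 a2 a3 a4 a5 a6 a7 : α) : Nat :=
  N8.rec (α := α) (motive := fun _ => Nat)
    (s)
    (fun b0 b1 b2 b3 b4 b5 b6 b7 => f (f (f (f (s) a4 b3) a5 b2) a6 b1) a7 b0) u
def dotH (α : Type) (f : Nat → α → α → Nat) (s : Nat) (t u : N8 α) : Nat :=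
  N8.rec (α := α) (motive := fun _ => Nat)
    (s)
    (dotH1 α f s u) t
def hdot : Nat → T3 → T3 → Nat := dotH T2 (dotN T1 (dotN L dot0))
def fin1 (v : Nat) (U : T3) : Nat :=
  Nat.mul (Bool.rec (motive := fun _ => Nat) 2 1 (Nat.beq v 24)) (hdot 0 (addE 12 v U .z) U)
def fin (K : Nat) (G : List T3) (l : List Nat) : Nat :=
  List.rec (motive := fun _ => Nat) 0
    (fun v _ ih => Nat.add ih (fin1 v (sumU t1 11 (Nat.sub K v) G 0))) l
def r5 (K : Nat) (l : List Nat) (tot : Nat) (G : List T3) : Bool :=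
  and' (chkL G) (Nat.beq (fin K G l) tot)
def r4 (K : Nat) (l : List Nat) (tot : Nat) (G : List T3) : Bool :=
  and' (chkL G) (r5 K l tot (mkG t1 9 K G vs))
def r3 (K : Nat) (l : List Nat) (tot : Nat) (G : List T3) : Bool :=
  and' (chkL G) (r4 K l tot (mkG t1 7 K G vs))
def r2 (K : Nat) (l : List Nat) (tot : Nat) (G : List T3) : Bool :=
  and' (chkL G) (r3 K l tot (mkG t1 5 K G vs))
def r1 (K : Nat) (l : List Nat) (tot : Nat) (G : List T3) : Bool :=
  and' (chkL G) (r2 K l tot (mkG t1 3 K G vs))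
def r0 (K : Nat) (l : List Nat) (tot : Nat) (G : List T3) : Bool :=
  and' (chkL G) (r1 K l tot (mkG t0 1 K G vs))
def run (K : Nat) (l : List Nat) (tot : Nat) : Bool := r0 K l tot (G0 vs)
end
end EM

namespace EM
/-! ### Base 256 digits -/
def dig (N i : ℕ) : ℕ := N / 256 ^ i % 256

theorem dig_le (N i : ℕ) : dig N i ≤ 255 := by
  have := Nat.mod_lt (N / 256 ^ i) (show 256 > 0 by norm_num)
  unfold dig; omega

theorem dig_zero (i : ℕ) : dig 0 i = 0 := by simp [dig]

theorem mod_succ (N i : ℕ) : N % 256 ^ (i + 1) = N % 256 ^ i + 256 ^ i * dig N i :=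
  Nat.mod_pow_succ

theorem dig_add_aux (a b : ℕ) (h : ∀ i, dig a i + dig b i ≤ 255) (i : ℕ) :
    a % 256 ^ i + b % 256 ^ i < 256 ^ i := by
  induction i with
  | zero => simp [Nat.mod_one]
  | succ i ih =>
    rw [mod_succ, mod_succ]
    have h1 := h i
    have h2 : 256 ^ i * dig a i + 256 ^ i * dig b i ≤ 256 ^ i * 255 := by
      rw [← Nat.mul_add]; exact Nat.mul_le_mul_left _ h1
    have h3 : 256 ^ (i + 1) = 256 ^ i * 255 + 256 ^ i := by ring
    omega

theorem dig_add (a b : ℕ) (h : ∀ i, dig a i + dig b i ≤ 255) (i : ℕ) :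
    dig (a + b) i = dig a i + dig b i := by
  have h1 := dig_add_aux a b h i
  have h2 : (a + b) / 256 ^ i = a / 256 ^ i + b / 256 ^ i :=
    Nat.add_div_eq_of_add_mod_lt h1
  have h3 := h i
  unfold dig at *
  rw [h2, Nat.add_mod]
  exact Nat.mod_eq_of_lt (by omega)

theorem dig_testBit (N i j : ℕ) : (dig N i).testBit j = (decide (j < 8) && N.testBit (8 * i + j)) := by
  have : dig N i = (N >>> (8 * i)) % 2 ^ 8 := by
    rw [Nat.shiftRight_eq_div_pow, pow_mul]; rfl
  rw [this, Nat.testBit_mod_two_pow, Nat.testBit_shiftRight]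

theorem dig_land (a b i : ℕ) : dig (Nat.land a b) i = (dig a i) &&& (dig b i) := by
  apply Nat.eq_of_testBit_eq
  intro j
  have : Nat.land a b = a &&& b := rfl
  rw [Nat.testBit_and, dig_testBit, dig_testBit, dig_testBit, this, Nat.testBit_and]
  cases decide (j < 8) <;> simp

theorem dig_lor (a b i : ℕ) : dig (Nat.lor a b) i = (dig a i) ||| (dig b i) := by
  apply Nat.eq_of_testBit_eq
  intro j
  have : Nat.lor a b = a ||| b := rfl
  rw [Nat.testBit_or, dig_testBit, dig_testBit, dig_testBit, this, Nat.testBit_or]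
  cases decide (j < 8) <;> simp

theorem dig_shl (a k i : ℕ) :
    dig (Nat.shiftLeft a (Nat.mul 8 k)) i = if i < k then 0 else dig a (i - k) := by
  have : Nat.shiftLeft a (Nat.mul 8 k) = a <<< (8 * k) := rfl
  apply Nat.eq_of_testBit_eq
  intro j
  rw [dig_testBit, this, Nat.testBit_shiftLeft]
  split_ifs with h
  · simp; omega
  · rw [dig_testBit]
    by_cases hj : j < 8
    · have e1 : 8 * i + j - 8 * k = 8 * (i - k) + j := by omega
      have e2 : 8 * i + j ≥ 8 * k := by omega
      simp [hj, e1, e2]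
    · simp [hj]

theorem land_255 (a : ℕ) (h : a ≤ 255) : a &&& 255 = a := by
  have : a &&& (2 ^ 8 - 1) = a % 2 ^ 8 := Nat.and_two_pow_sub_one_eq_mod a 8
  norm_num at this
  rw [this]; omega

/-! ### Lane indices -/
def idx : ℕ → Finset ℕ → ℕ
  | 0, _ => 0
  | k + 1, S => idx k S + if k + 1 ∈ S then 2 ^ k else 0
def cnt : ℕ → Finset ℕ → ℕ
  | 0, _ => 0
  | k + 1, S => cnt k S + if k + 1 ∈ S then 1 else 0

theorem idx_lt (k : ℕ) (S : Finset ℕ) : idx k S < 2 ^ k := by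
  induction k with
  | zero => simp [idx]
  | succ k ih => rw [idx, pow_succ]; split_ifs <;> omega

theorem idx_congr (k : ℕ) (S T : Finset ℕ) (h : ∀ e ≤ k, (e ∈ S ↔ e ∈ T)) :
    idx k S = idx k T := by
  induction k with
  | zero => rfl
  | succ k ih => rw [idx, idx, ih (fun e he => h e (by omega))]; simp only [h (k + 1) le_rfl]

theorem cnt_congr (k : ℕ) (S T : Finset ℕ) (h : ∀ e ≤ k, (e ∈ S ↔ e ∈ T)) :
    cnt k S = cnt k T := by
  induction k with
  | zero => rfl
  | succ k ih => rw [cnt, cnt, ih (fun e he => h e (by omega))]; simp only [h (k + 1) le_rfl]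

theorem idx_erase (k : ℕ) (S : Finset ℕ) (e : ℕ) (he : e < k) (h : e + 1 ∈ S) :
    idx k (S.erase (e + 1)) + 2 ^ e = idx k S := by
  induction k with
  | zero => omega
  | succ k ih =>
    rw [idx, idx]
    by_cases hk : e = k
    · subst hk
      rw [idx_congr e (S.erase (e + 1)) S]
      · simp [h]
      · intro e' he'; simp; omega
    · have := ih (by omega)
      have h2 : (k + 1 ∈ S.erase (e + 1)) ↔ k + 1 ∈ S := by simp; omega
      simp only [h2]; omega

theorem idx_surj (k i : ℕ) (h : i < 2 ^ k) : ∃ S : Finset ℕ, idx k S = i := by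
  induction k generalizing i with
  | zero => exact ⟨∅, by simp [idx]; omega⟩
  | succ k ih =>
    by_cases hi : i < 2 ^ k
    · obtain ⟨S, hS⟩ := ih i hi
      refine ⟨S.erase (k + 1), ?_⟩
      rw [idx, idx_congr k _ S]
      · simp [hS]
      · intro e he; simp; omega
    · obtain ⟨S, hS⟩ := ih (i - 2 ^ k) (by rw [pow_succ] at h; omega)
      refine ⟨insert (k + 1) S, ?_⟩
      rw [idx, idx_congr k _ S]
      · simp [hS]; omega
      · intro e he; simp; omega

theorem idx_inj (k : ℕ) (S T : Finset ℕ) (h : idx k S = idx k T) (e : ℕ) (he : 1 ≤ e) (hk : e ≤ k) :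
    e ∈ S ↔ e ∈ T := by
  induction k with
  | zero => omega
  | succ k ih =>
    rw [idx, idx] at h
    have h1 := idx_lt k S
    have h2 := idx_lt k T
    have h3 : (k + 1 ∈ S ↔ k + 1 ∈ T) ∧ idx k S = idx k T := by
      by_cases hS : k + 1 ∈ S <;> by_cases hT : k + 1 ∈ T <;> simp [hS, hT] at h ⊢ <;> omega
    by_cases hek : e = k + 1
    · subst hek; exact h3.1
    · exact ih h3.2 (by omega)

/-- digits vanish from `2^k` on -/
def Z (k N : ℕ) : Prop := ∀ i, 2 ^ k ≤ i → dig N i = 0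

theorem Z_succ {k N : ℕ} (h : Z k N) : Z (k + 1) N := fun i hi => h i (by rw [pow_succ] at hi; omega)

theorem dig_sh0 (k N i : ℕ) :
    dig (Nat.shiftLeft N (Nat.mul 8 (Nat.pow 2 k))) i =
      if i < 2 ^ k then 0 else dig N (i - 2 ^ k) := dig_shl N (2 ^ k) i

/-- doubling -/
theorem dig_dbl (k A B : ℕ) (hA : Z k A) (hB : Z k B) :
    Z (k + 1) (Nat.add A (Nat.shiftLeft B (Nat.mul 8 (Nat.pow 2 k)))) ∧
    ∀ S, dig (Nat.add A (Nat.shiftLeft B (Nat.mul 8 (Nat.pow 2 k)))) (idx (k + 1) S) =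
      if k + 1 ∈ S then dig B (idx k S) else dig A (idx k S) := by
  have hb := dig_sh0 k B
  have hh : ∀ i, dig A i + dig (Nat.shiftLeft B (Nat.mul 8 (Nat.pow 2 k))) i =
      if i < 2 ^ k then dig A i else dig B (i - 2 ^ k) := by
    intro i
    rw [hb i]
    split_ifs with h
    · rfl
    · rw [hA i (by omega), Nat.zero_add]
  have hd : ∀ i, dig (Nat.add A (Nat.shiftLeft B (Nat.mul 8 (Nat.pow 2 k)))) i =
      if i < 2 ^ k then dig A i else dig B (i - 2 ^ k) := by
    intro i
    rw [← hh i]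
    apply dig_add
    intro i
    rw [hh i]
    split_ifs <;> apply dig_le
  constructor
  · intro i hi
    rw [pow_succ] at hi
    rw [hd, if_neg (by omega)]
    exact hB _ (by omega)
  · intro S
    have := idx_lt k S
    rw [hd, idx]
    by_cases h2 : k + 1 ∈ S
    · rw [if_pos h2, if_pos h2, if_neg (by omega), Nat.add_sub_cancel]
    · rw [if_neg h2, if_neg h2, if_pos (by omega), Nat.add_zero]

theorem rep_spec (c : ℕ) (hc : c ≤ 255) (g : ℕ → Bool) (k : ℕ) :
    Z k (rep c g k) ∧ ∀ S, dig (rep c g k) (idx k S) =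
      if ∀ i < k, g i = true → i + 1 ∉ S then c else 0 := by
  induction k with
  | zero =>
    constructor
    · intro i hi
      show c / 256 ^ i % 256 = 0
      rw [Nat.div_eq_of_lt]
      simp at hi
      calc c < 256 ^ 1 := by omega
        _ ≤ 256 ^ i := Nat.pow_le_pow_right (by norm_num) hi
    · intro S
      simp only [idx, not_lt_zero, IsEmpty.forall_iff, implies_true, if_true]
      show c / 256 ^ 0 % 256 = c
      simp; omega
  | succ k ih =>
    obtain ⟨h1, h2⟩ := ih
    cases hg : g k with
    | false =>
      have e : rep c g (k + 1) = Nat.add (rep c g k) (Nat.shiftLeft (rep c g k) (Nat.mul 8 (Nat.pow 2 k))) := by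
        show Bool.rec (motive := fun _ => Nat) _ _ (g k) = _
        rw [hg]; rfl
      rw [e]
      obtain ⟨h3, h4⟩ := dig_dbl k _ _ h1 h1
      refine ⟨h3, fun S => ?_⟩
      rw [h4, ite_self, h2]
      have : (∀ i < k, g i = true → i + 1 ∉ S) ↔ (∀ i < k + 1, g i = true → i + 1 ∉ S) := by
        constructor
        · intro h i hi hgi
          apply h i _ hgi
          by_contra h'
          have : i = k := by omega
          subst this; simp_all
        · intro h i hi; exact h i (by omega)
      simp only [this]
    | true =>
      have e : rep c g (k + 1) = rep c g k := by
        show Bool.rec (motive := fun _ => Nat) _ _ (g k) = _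
        rw [hg]; rfl
      rw [e]
      refine ⟨Z_succ h1, fun S => ?_⟩
      rw [idx]
      by_cases hS : k + 1 ∈ S
      · rw [if_pos hS, h1 _ (by omega), if_neg]
        intro h; exact h k (by omega) hg hS
      · rw [if_neg hS, Nat.add_zero, h2]
        have : (∀ i < k, g i = true → i + 1 ∉ S) ↔ (∀ i < k + 1, g i = true → i + 1 ∉ S) := by
          constructor
          · intro h i hi hgi
            by_cases h' : i = k
            · subst h'; exact hS
            · exact h i (by omega) hgi
          · intro h i hi; exact h i (by omega)
        simp only [this]

theorem msk_spec (e : ℕ) (he : e < 15) :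
    Z 15 (msk e) ∧ ∀ S, dig (msk e) (idx 15 S) = if e + 1 ∈ S then 0 else 255 := by
  obtain ⟨h1, h2⟩ := rep_spec 255 le_rfl (fun i => Nat.beq i e) 15
  refine ⟨h1, fun S => ?_⟩
  show dig (rep 255 (fun i => Nat.beq i e) 15) _ = _
  rw [h2]
  have : (∀ i < 15, Nat.beq i e = true → i + 1 ∉ S) ↔ ¬ e + 1 ∈ S := by
    constructor
    · intro h; exact h e he (Nat.beq_refl e)
    · intro h i _ hi
      have := Nat.eq_of_beq_eq_true hi
      subst this; exact h
  simp only [this, ite_not]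

theorem cst_spec (c : ℕ) (hc : c ≤ 255) : Z 15 (cst c) ∧ ∀ i < 2 ^ 15, dig (cst c) i = c := by
  obtain ⟨h1, h2⟩ := rep_spec c hc (fun _ => false) 15
  refine ⟨h1, fun i hi => ?_⟩
  obtain ⟨S, rfl⟩ := idx_surj 15 i hi
  show dig (rep c (fun _ => false) 15) _ = _
  rw [h2]; simp

theorem nth_step (s : ℕ) (l : List ℕ) (c q : ℕ) :
    nth (step s l c) q = Nat.add (nth l q) (match q with | 0 => c | q + 1 => Nat.shiftLeft (nth l q) s) := by
  induction l generalizing c q with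
  | nil =>
    cases q with
    | zero => show c = 0 + c; omega
    | succ q =>
      show 0 = 0 + Nat.shiftLeft 0 s
      show 0 = 0 + 0 <<< s
      simp
  | cons a l ih =>
    cases q with
    | zero => rfl
    | succ q =>
      show nth (step s l (Nat.shiftLeft a s)) q = Nat.add (nth l q) (Nat.shiftLeft (nth (a :: l) q) s)
      rw [ih]
      cases q with
      | zero => rfl
      | succ q => rfl

theorem rows_spec (k q : ℕ) : Z k (nth (rows k) q) ∧ ∀ S, dig (nth (rows k) q) (idx k S) =
    if cnt k S = q then 255 else 0 := by
  induction k generalizing q with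
  | zero =>
    cases q with
    | zero =>
      constructor
      · intro i hi
        show 255 / 256 ^ i % 256 = 0
        rw [Nat.div_eq_of_lt]
        simp at hi
        calc 255 < 256 ^ 1 := by omega
          _ ≤ 256 ^ i := Nat.pow_le_pow_right (by norm_num) hi
      · intro S
        show 255 / 256 ^ 0 % 256 = if 0 = 0 then 255 else 0
        simp
    | succ q =>
      constructor
      · intro i hi
        exact dig_zero i
      · intro S
        show dig 0 _ = if 0 = q + 1 then 255 else 0
        rw [dig_zero]; simp
  | succ k ih =>
    have e : nth (rows (k + 1)) q = nth (step (Nat.mul 8 (Nat.pow 2 k)) (rows k) 0) q := rfl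
    rw [e, nth_step]
    cases q with
    | zero =>
      have e2 : (Nat.add (nth (rows k) 0) 0) = nth (rows k) 0 := rfl
      simp only [e2]
      refine ⟨Z_succ (ih 0).1, fun S => ?_⟩
      rw [idx, cnt]
      by_cases hS : k + 1 ∈ S
      · rw [if_pos hS, (ih 0).1 _ (by omega), if_neg (by simp [hS])]
      · simp [hS, (ih 0).2]
    | succ q =>
      obtain ⟨h1, h2⟩ := dig_dbl k _ _ (ih (q + 1)).1 (ih q).1
      refine ⟨h1, fun S => ?_⟩
      simp only
      rw [h2, (ih _).2, (ih _).2, cnt]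
      by_cases hS : k + 1 ∈ S <;> simp [hS]

theorem PM_spec (q : ℕ) : Z 15 (PM q) ∧ ∀ S, dig (PM q) (idx 15 S) =
    if cnt 15 S = q then 255 else 0 := rows_spec 15 q
end EM

namespace EM
/-! ### Semantics of trees -/
structure Sem (α : Type) where
  sm : α → Finset ℕ → ℕ
  bd : ℕ → α → Prop
  zz : α
  top : ℕ
  mono : ∀ a b t, a ≤ b → bd a t → bd b t
  zbd : ∀ b, bd b zz
  zsm : ∀ S, sm zz S = 0
  loc : ∀ t S e, top < e → sm t (S.erase e) = sm t S

def sm0 : L → Finset ℕ → ℕ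
  | .z, _ => 0
  | .lf N, S => dig N (idx 15 S)
def bd0 (b : ℕ) : L → Prop
  | .z => True
  | .lf N => (∀ i, dig N i ≤ b) ∧ Z 15 N

def Sem0 : Sem L where
  sm := sm0
  bd := bd0
  zz := .z
  top := 15
  mono a b t h := by
    cases t with
    | z => exact id
    | lf N => exact fun h1 => ⟨fun i => (h1.1 i).trans h, h1.2⟩
  zbd _ := trivial
  zsm _ := rfl
  loc t S e h := by
    cases t with
    | z => rfl
    | lf N =>
      show dig N _ = dig N _
      rw [idx_congr 15 (S.erase e) S]
      intro e' he'; simp; omega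

variable {α : Type}

def sel (k : ℕ) (S : Finset ℕ) (a0 a1 a2 a3 a4 a5 a6 a7 : α) : α :=
  if k + 3 ∈ S then
    if k + 2 ∈ S then (if k + 1 ∈ S then a7 else a6) else (if k + 1 ∈ S then a5 else a4)
  else
    if k + 2 ∈ S then (if k + 1 ∈ S then a3 else a2) else (if k + 1 ∈ S then a1 else a0)

def sm8 (s : Sem α) : N8 α → Finset ℕ → ℕ
  | .z, _ => 0
  | .n a0 a1 a2 a3 a4 a5 a6 a7, S => s.sm (sel s.top S a0 a1 a2 a3 a4 a5 a6 a7) S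
def bd8 (s : Sem α) (b : ℕ) : N8 α → Prop
  | .z => True
  | .n a0 a1 a2 a3 a4 a5 a6 a7 => s.bd b a0 ∧ s.bd b a1 ∧ s.bd b a2 ∧ s.bd b a3 ∧
      s.bd b a4 ∧ s.bd b a5 ∧ s.bd b a6 ∧ s.bd b a7

theorem sel_congr (k : ℕ) (S T : Finset ℕ) (h : ∀ j, k < j → j ≤ k + 3 → (j ∈ S ↔ j ∈ T))
    (a0 a1 a2 a3 a4 a5 a6 a7 : α) :
    sel k S a0 a1 a2 a3 a4 a5 a6 a7 = sel k T a0 a1 a2 a3 a4 a5 a6 a7 := by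
  unfold sel
  simp only [h (k + 1) (by omega) (by omega), h (k + 2) (by omega) (by omega),
    h (k + 3) (by omega) (by omega)]

def Sem8 (s : Sem α) : Sem (N8 α) where
  sm := sm8 s
  bd := bd8 s
  zz := .z
  top := s.top + 3
  mono a b t h := by
    cases t with
    | z => exact id
    | n a0 a1 a2 a3 a4 a5 a6 a7 =>
      rintro ⟨h0, h1, h2, h3, h4, h5, h6, h7⟩
      exact ⟨s.mono _ _ _ h h0, s.mono _ _ _ h h1, s.mono _ _ _ h h2, s.mono _ _ _ h h3,
        s.mono _ _ _ h h4, s.mono _ _ _ h h5, s.mono _ _ _ h h6, s.mono _ _ _ h h7⟩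
  zbd _ := trivial
  zsm _ := rfl
  loc t S e h := by
    cases t with
    | z => rfl
    | n a0 a1 a2 a3 a4 a5 a6 a7 =>
      show s.sm _ _ = s.sm _ _
      rw [s.loc _ _ _ (by omega), sel_congr s.top (S.erase e) S]
      intro j _ _; simp; omega

abbrev Op := (Finset ℕ → ℕ) → Finset ℕ → ℕ

def Impl (s : Sem α) (f : α → α → α) (F : Op) : Prop :=
  ∀ a b t u, s.bd a t → s.bd b u → a + b ≤ 255 →
    s.bd (a + b) (f t u) ∧ ∀ S, s.sm (f t u) S = F (s.sm t) S + s.sm u S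

def idF : Op := fun g S => g S
def eF (e : ℕ) : Op := fun g S => if e ∈ S then g (S.erase e) else 0
def mF (k p c : ℕ) : Op := fun g S => if c + cnt k S = p then g S else 0

theorem addIL1_spec (a b N : ℕ) (u : L) (hN : ∀ i, dig N i ≤ a) (hZ : Z 15 N) (hu : bd0 b u)
    (hab : a + b ≤ 255) :
    bd0 (a + b) (addIL1 N u) ∧ ∀ S, sm0 (addIL1 N u) S = dig N (idx 15 S) + sm0 u S := by
  cases u with
  | z => exact ⟨⟨fun i => (hN i).trans (by omega), hZ⟩, fun S => rfl⟩
  | lf M =>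
    obtain ⟨hu1, hu2⟩ := hu
    have h : ∀ i, dig N i + dig M i ≤ 255 := fun i => by
      have := hN i; have := hu1 i; omega
    have h2 := dig_add N M h
    refine ⟨⟨fun i => ?_, fun i hi => ?_⟩, fun S => ?_⟩
    · show dig (N + M) i ≤ _
      rw [h2]
      have := hN i; have := hu1 i; omega
    · show dig (N + M) i = _
      rw [h2, hZ i hi, hu2 i hi]
    · show dig (N + M) _ = _
      rw [h2]; rfl

theorem addL_spec : Impl Sem0 addL idF := by
  intro a b t u ht hu hab
  cases t with
  | z => exact ⟨Sem0.mono b (a + b) u (by omega) hu, fun S => (Nat.zero_add _).symm⟩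
  | lf N =>
    have e : addL (.lf N) u = addIL1 N u := by cases u <;> rfl
    rw [e]
    exact addIL1_spec a b N u ht.1 ht.2 hu hab

theorem land_mask_le (N M i : ℕ) : dig (Nat.land N M) i ≤ dig N i := by
  rw [dig_land]; exact Nat.and_le_left

theorem addIL_spec (e : ℕ) (he : e < 15) :
    Impl Sem0 (addIL (msk e) (Nat.mul 8 (Nat.pow 2 e))) (eF (e + 1)) := by
  intro a b t u ht hu hab
  cases t with
  | z =>
    refine ⟨Sem0.mono b (a + b) u (by omega) hu, fun S => ?_⟩
    show sm0 u S = _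
    simp [eF, Sem0, sm0]
  | lf N =>
    obtain ⟨hN, hZ⟩ := ht
    obtain ⟨m1, m2⟩ := msk_spec e he
    have hl : ∀ S, dig (Nat.land N (msk e)) (idx 15 S) = if e + 1 ∈ S then 0 else dig N (idx 15 S) := by
      intro S
      rw [dig_land, m2]
      split_ifs
      · simp
      · exact land_255 _ (dig_le _ _)
    have hs := dig_shl (Nat.land N (msk e)) (2 ^ e)
    have hs' : ∀ i, dig (Nat.shiftLeft (Nat.land N (msk e)) (Nat.mul 8 (Nat.pow 2 e))) i = _ := hs
    have := addIL1_spec a b (Nat.shiftLeft (Nat.land N (msk e)) (Nat.mul 8 (Nat.pow 2 e))) u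
      (fun i => by
        rw [hs']; split_ifs
        · omega
        · exact (land_mask_le _ _ _).trans (hN _))
      (fun i hi => by
        rw [hs']
        split_ifs with h1
        · rfl
        · by_cases h2 : i - 2 ^ e < 2 ^ 15
          · obtain ⟨S, hS⟩ := idx_surj 15 _ h2
            rw [← hS, hl]
            split_ifs with h3
            · rfl
            · exfalso
              have h4 := idx_erase 15 (insert (e + 1) S) e he (by simp)
              rw [Finset.erase_insert h3] at h4
              have := idx_lt 15 (insert (e + 1) S)
              omega
          · have := land_mask_le N (msk e) (i - 2 ^ e)
            rw [hZ _ (by omega)] at this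
            omega)
      hu hab
    refine ⟨this.1, fun S => ?_⟩
    have h5 := this.2 S
    show sm0 _ S = _
    refine Eq.trans h5 ?_
    congr 1
    rw [hs']
    show _ = if e + 1 ∈ S then dig N (idx 15 (S.erase (e + 1))) else 0
    by_cases h : e + 1 ∈ S
    · have h6 := idx_erase 15 S e he h
      have h7 := hl (S.erase (e + 1))
      rw [if_pos h, if_neg (by omega), ← h6, Nat.add_sub_cancel, h7, if_neg (by simp)]
    · rw [if_neg h]
      split_ifs with h8
      · rfl
      · have h9 : idx 15 S - 2 ^ e < 2 ^ 15 := 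
          lt_of_le_of_lt (Nat.sub_le _ _) (idx_lt 15 S)
        obtain ⟨T, hT⟩ := idx_surj 15 _ h9
        rw [← hT, hl]
        split_ifs with h10
        · rfl
        · exfalso
          have h4 := idx_erase 15 (insert (e + 1) T) e he (by simp)
          rw [Finset.erase_insert h10] at h4
          have h11 : idx 15 (insert (e + 1) T) = idx 15 S := by omega
          exact h ((idx_inj 15 _ _ h11 (e + 1) (by omega) (by omega)).1 (by simp))
end EM

namespace EM
variable {α : Type}
theorem addML_spec (p c : ℕ) : Impl Sem0 (addML p c) (mF 15 p c) := by
  intro a b t u ht hu hab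
  have hz : Sem0.bd (a + b) u ∧ ∀ S, Sem0.sm u S = 0 + Sem0.sm u S :=
    ⟨Sem0.mono b (a + b) u (by omega) hu, fun S => (Nat.zero_add _).symm⟩
  cases hcp : Nat.ble c p with
  | false =>
    have e : addML p c t u = u := by unfold addML; rw [hcp]
    rw [e]
    have hcp' : ¬ c ≤ p := fun h => by rw [Nat.ble_eq_true_of_le h] at hcp; cases hcp
    refine ⟨hz.1, fun S => ?_⟩
    rw [hz.2 S]
    simp only [mF]
    rw [if_neg (by omega)]; omega
  | true =>
    have hcp' := Nat.le_of_ble_eq_true hcp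
    cases t with
    | z =>
      have e : addML p c .z u = u := by unfold addML; rw [hcp]
      rw [e]
      refine ⟨hz.1, fun S => ?_⟩
      rw [hz.2 S]
      simp only [mF]
      congr 1
      · simp [Sem0, sm0]
      · omega
    | lf N =>
      have e : addML p c (.lf N) u = addIL1 (Nat.land N (PM (Nat.sub p c))) u := by
        unfold addML; rw [hcp]
      rw [e]
      obtain ⟨hN, hZ⟩ := ht
      have := addIL1_spec a b (Nat.land N (PM (Nat.sub p c))) u
        (fun i => (land_mask_le _ _ _).trans (hN _))
        (fun i hi => by have := land_mask_le N (PM (Nat.sub p c)) i; rw [hZ i hi] at this; omega)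
        hu hab
      refine ⟨this.1, fun S => ?_⟩
      refine Eq.trans (this.2 S) ?_
      congr 1
      rw [dig_land, (PM_spec _).2]
      show _ = if c + cnt 15 S = p then dig N (idx 15 S) else 0
      have : cnt 15 S = Nat.sub p c ↔ c + cnt 15 S = p := by
        show cnt 15 S = p - c ↔ _
        omega
      simp only [this]
      split_ifs
      · exact land_255 _ (dig_le _ _)
      · simp

theorem sel_map {β : Type} (f : α → β) (k : ℕ) (S : Finset ℕ) (a0 a1 a2 a3 a4 a5 a6 a7 : α) :
    f (sel k S a0 a1 a2 a3 a4 a5 a6 a7) =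
      sel k S (f a0) (f a1) (f a2) (f a3) (f a4) (f a5) (f a6) (f a7) := by
  unfold sel; split_ifs <;> rfl

theorem sel_map2 {β : Type} (f : α → α → β) (k : ℕ) (S : Finset ℕ) (a0 a1 a2 a3 a4 a5 a6 a7 : α)
    (b0 b1 b2 b3 b4 b5 b6 b7 : α) :
    f (sel k S a0 a1 a2 a3 a4 a5 a6 a7) (sel k S b0 b1 b2 b3 b4 b5 b6 b7) =
      sel k S (f a0 b0) (f a1 b1) (f a2 b2) (f a3 b3) (f a4 b4) (f a5 b5) (f a6 b6) (f a7 b7) := by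
  unfold sel; split_ifs <;> rfl

theorem sel_prop (P : α → Prop) (k : ℕ) (S : Finset ℕ) (a0 a1 a2 a3 a4 a5 a6 a7 : α)
    (h : P a0 ∧ P a1 ∧ P a2 ∧ P a3 ∧ P a4 ∧ P a5 ∧ P a6 ∧ P a7) :
    P (sel k S a0 a1 a2 a3 a4 a5 a6 a7) := by
  obtain ⟨h0, h1, h2, h3, h4, h5, h6, h7⟩ := h
  unfold sel; split_ifs <;> assumption

theorem add_spec (s : Sem α) (f : α → α → α) (hf : Impl s f idF) :
    Impl (Sem8 s) (add α f) idF := by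
  intro a b t u ht hu hab
  cases t with
  | z => exact ⟨(Sem8 s).mono b (a + b) u (by omega) hu, fun S => (Nat.zero_add _).symm⟩
  | n a0 a1 a2 a3 a4 a5 a6 a7 =>
    cases u with
    | z => exact ⟨(Sem8 s).mono a (a + b) _ (by omega) ht, fun S => rfl⟩
    | n b0 b1 b2 b3 b4 b5 b6 b7 =>
      have key := fun S => hf a b _ _ (sel_prop _ s.top S _ _ _ _ _ _ _ _ ht)
        (sel_prop _ s.top S _ _ _ _ _ _ _ _ hu) hab
      obtain ⟨h0, h1, h2, h3, h4, h5, h6, h7⟩ := ht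
      obtain ⟨g0, g1, g2, g3, g4, g5, g6, g7⟩ := hu
      refine ⟨⟨(hf a b _ _ h0 g0 hab).1, (hf a b _ _ h1 g1 hab).1, (hf a b _ _ h2 g2 hab).1,
        (hf a b _ _ h3 g3 hab).1, (hf a b _ _ h4 g4 hab).1, (hf a b _ _ h5 g5 hab).1,
        (hf a b _ _ h6 g6 hab).1, (hf a b _ _ h7 g7 hab).1⟩, fun S => ?_⟩
      have := (key S).2 S
      rw [sel_map2 f] at this
      exact this

theorem addz_spec (s : Sem α) (f : α → α → α) (F : Op) (hf : Impl s f F)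
    (hF : ∀ g g' : Finset ℕ → ℕ, ∀ S, (∀ S', (∀ j, s.top < j → (j ∈ S' ↔ j ∈ S)) → g S' = g' S') →
      F g S = F g' S) (hF0 : ∀ S, F (fun _ => 0) S = 0) :
    Impl (Sem8 s) (addz α f s.zz) F := by
  have main : ∀ a b a0 a1 a2 a3 a4 a5 a6 a7 b0 b1 b2 b3 b4 b5 b6 b7,
      (Sem8 s).bd a (.n a0 a1 a2 a3 a4 a5 a6 a7) → (Sem8 s).bd b (.n b0 b1 b2 b3 b4 b5 b6 b7) →
      a + b ≤ 255 →
      (Sem8 s).bd (a + b) (add2 α f a0 a1 a2 a3 a4 a5 a6 a7 b0 b1 b2 b3 b4 b5 b6 b7) ∧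
      ∀ S, (Sem8 s).sm (add2 α f a0 a1 a2 a3 a4 a5 a6 a7 b0 b1 b2 b3 b4 b5 b6 b7) S =
        F ((Sem8 s).sm (.n a0 a1 a2 a3 a4 a5 a6 a7)) S +
          (Sem8 s).sm (.n b0 b1 b2 b3 b4 b5 b6 b7) S := by
    intro a b a0 a1 a2 a3 a4 a5 a6 a7 b0 b1 b2 b3 b4 b5 b6 b7 ht hu hab
    have key := fun S => hf a b _ _ (sel_prop _ s.top S _ _ _ _ _ _ _ _ ht)
      (sel_prop _ s.top S _ _ _ _ _ _ _ _ hu) hab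
    obtain ⟨h0, h1, h2, h3, h4, h5, h6, h7⟩ := ht
    obtain ⟨g0, g1, g2, g3, g4, g5, g6, g7⟩ := hu
    refine ⟨⟨(hf a b _ _ h0 g0 hab).1, (hf a b _ _ h1 g1 hab).1, (hf a b _ _ h2 g2 hab).1,
      (hf a b _ _ h3 g3 hab).1, (hf a b _ _ h4 g4 hab).1, (hf a b _ _ h5 g5 hab).1,
      (hf a b _ _ h6 g6 hab).1, (hf a b _ _ h7 g7 hab).1⟩, fun S => ?_⟩
    have := (key S).2 S
    rw [sel_map2 f] at this
    refine this.trans ?_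
    congr 1
    apply hF
    intro S' hS'
    show _ = s.sm (sel s.top S' _ _ _ _ _ _ _ _) S'
    rw [sel_congr s.top S' S (fun j hj _ => hS' j hj)]
  intro a b t u ht hu hab
  cases t with
  | z =>
    refine ⟨(Sem8 s).mono b (a + b) u (by omega) hu, fun S => ?_⟩
    have : F ((Sem8 s).sm .z) S = 0 := hF0 S
    rw [this, Nat.zero_add]; rfl
  | n a0 a1 a2 a3 a4 a5 a6 a7 =>
    cases u with
    | z =>
      have := main a b a0 a1 a2 a3 a4 a5 a6 a7 _ _ _ _ _ _ _ _ ht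
        ⟨s.zbd b, s.zbd b, s.zbd b, s.zbd b, s.zbd b, s.zbd b, s.zbd b, s.zbd b⟩ hab
      refine ⟨this.1, fun S => ?_⟩
      refine (this.2 S).trans ?_
      congr 1
      show s.sm (sel s.top S _ _ _ _ _ _ _ _) S = 0
      unfold sel; split_ifs <;> exact s.zsm S
    | n b0 b1 b2 b3 b4 b5 b6 b7 => exact main a b _ _ _ _ _ _ _ _ _ _ _ _ _ _ _ _ ht hu hab

theorem addc_spec (s : Sem α) (f : ℕ → α → α → α) (p : ℕ) (hf : ∀ c, Impl s (f c) (mF s.top p c))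
    (c : ℕ) : Impl (Sem8 s) (addc α f c s.zz) (mF (s.top + 3) p c) := by
  have hc : ∀ S, cnt (s.top + 3) S = cnt s.top S + (if s.top + 1 ∈ S then 1 else 0) +
      (if s.top + 2 ∈ S then 1 else 0) + (if s.top + 3 ∈ S then 1 else 0) := fun S => rfl
  have main : ∀ a b a0 a1 a2 a3 a4 a5 a6 a7 b0 b1 b2 b3 b4 b5 b6 b7,
      (Sem8 s).bd a (.n a0 a1 a2 a3 a4 a5 a6 a7) → (Sem8 s).bd b (.n b0 b1 b2 b3 b4 b5 b6 b7) →
      a + b ≤ 255 →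
      (Sem8 s).bd (a + b) (addc α f c s.zz (.n a0 a1 a2 a3 a4 a5 a6 a7) (.n b0 b1 b2 b3 b4 b5 b6 b7)) ∧
      ∀ S, (Sem8 s).sm (addc α f c s.zz (.n a0 a1 a2 a3 a4 a5 a6 a7) (.n b0 b1 b2 b3 b4 b5 b6 b7)) S =
        mF (s.top + 3) p c ((Sem8 s).sm (.n a0 a1 a2 a3 a4 a5 a6 a7)) S +
          (Sem8 s).sm (.n b0 b1 b2 b3 b4 b5 b6 b7) S := by
    intro a b a0 a1 a2 a3 a4 a5 a6 a7 b0 b1 b2 b3 b4 b5 b6 b7 ht hu hab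
    obtain ⟨h0, h1, h2, h3, h4, h5, h6, h7⟩ := ht
    obtain ⟨g0, g1, g2, g3, g4, g5, g6, g7⟩ := hu
    have k0 := hf (c + 0) a b _ _ h0 g0 hab
    have k1 := hf (c + 1) a b _ _ h1 g1 hab
    have k2 := hf (c + 1) a b _ _ h2 g2 hab
    have k3 := hf (c + 2) a b _ _ h3 g3 hab
    have k4 := hf (c + 1) a b _ _ h4 g4 hab
    have k5 := hf (c + 2) a b _ _ h5 g5 hab
    have k6 := hf (c + 2) a b _ _ h6 g6 hab
    have k7 := hf (c + 3) a b _ _ h7 g7 hab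
    refine ⟨⟨k0.1, k1.1, k2.1, k3.1, k4.1, k5.1, k6.1, k7.1⟩, fun S => ?_⟩
    show s.sm (sel s.top S (f (c + 0) a0 b0) (f (c + 1) a1 b1) (f (c + 1) a2 b2) (f (c + 2) a3 b3)
      (f (c + 1) a4 b4) (f (c + 2) a5 b5) (f (c + 2) a6 b6) (f (c + 3) a7 b7)) S =
      (if c + cnt (s.top + 3) S = p then s.sm (sel s.top S a0 a1 a2 a3 a4 a5 a6 a7) S else 0) +
      s.sm (sel s.top S b0 b1 b2 b3 b4 b5 b6 b7) S
    replace k0 := k0.2 S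
    replace k1 := k1.2 S
    replace k2 := k2.2 S
    replace k3 := k3.2 S
    replace k4 := k4.2 S
    replace k5 := k5.2 S
    replace k6 := k6.2 S
    replace k7 := k7.2 S
    simp only [mF] at k0 k1 k2 k3 k4 k5 k6 k7
    rw [hc]
    unfold sel
    split_ifs <;> simp only [k0, k1, k2, k3, k4, k5, k6, k7] <;> congr 1 <;> split_ifs <;> omega
  intro a b t u ht hu hab
  cases t with
  | z =>
    refine ⟨(Sem8 s).mono b (a + b) u (by omega) hu, fun S => ?_⟩
    have : mF (s.top + 3) p c ((Sem8 s).sm .z) S = 0 := by simp [mF, Sem8, sm8]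
    rw [this, Nat.zero_add]; rfl
  | n a0 a1 a2 a3 a4 a5 a6 a7 =>
    cases u with
    | z =>
      have := main a b a0 a1 a2 a3 a4 a5 a6 a7 _ _ _ _ _ _ _ _ ht
        ⟨s.zbd b, s.zbd b, s.zbd b, s.zbd b, s.zbd b, s.zbd b, s.zbd b, s.zbd b⟩ hab
      refine ⟨this.1, fun S => ?_⟩
      refine (this.2 S).trans ?_
      congr 1
      show s.sm (sel s.top S _ _ _ _ _ _ _ _) S = 0
      unfold sel; split_ifs <;> exact s.zsm S
    | n b0 b1 b2 b3 b4 b5 b6 b7 => exact main a b _ _ _ _ _ _ _ _ _ _ _ _ _ _ _ _ ht hu hab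
end EM

namespace EM
variable {α : Type}

theorem ins0_spec (s : Sem α) (f : α → α → α) (hf : Impl s f idF) :
    Impl (Sem8 s) (ins0 α f s.zz) (eF (s.top + 3)) := by
  intro a b t u ht hu hab
  cases t with
  | z =>
    refine ⟨(Sem8 s).mono b (a + b) u (by omega) hu, fun S => ?_⟩
    have : eF (s.top + 3) ((Sem8 s).sm .z) S = 0 := by simp [eF, Sem8, sm8]
    rw [this, Nat.zero_add]; rfl
  | n a0 a1 a2 a3 a4 a5 a6 a7 =>
    obtain ⟨h0, h1, h2, h3, h4, h5, h6, h7⟩ := ht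
    have hl : ∀ S x, s.sm x (S.erase (s.top + 3)) = s.sm x S :=
      fun S x => s.loc x S _ (by omega)
    cases u with
    | z =>
      have m := fun x (h : s.bd a x) => s.mono a (a + b) x (by omega) h
      have zb := s.zbd (a + b)
      refine ⟨⟨zb, zb, zb, zb, m _ h0, m _ h1, m _ h2, m _ h3⟩, fun S => ?_⟩
      show s.sm (sel s.top S s.zz s.zz s.zz s.zz a0 a1 a2 a3) S =
        (if s.top + 3 ∈ S then s.sm (sel s.top (S.erase (s.top + 3)) a0 a1 a2 a3 a4 a5 a6 a7)
          (S.erase (s.top + 3)) else 0) + 0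
      rw [hl]
      unfold sel
      by_cases c1 : s.top + 1 ∈ S <;> by_cases c2 : s.top + 2 ∈ S <;> by_cases c3 : s.top + 3 ∈ S <;>
        simp [c1, c2, c3, s.zsm]
    | n b0 b1 b2 b3 b4 b5 b6 b7 =>
      obtain ⟨g0, g1, g2, g3, g4, g5, g6, g7⟩ := hu
      have m := fun x (h : s.bd b x) => s.mono b (a + b) x (by omega) h
      have k4 := hf a b _ _ h0 g4 hab
      have k5 := hf a b _ _ h1 g5 hab
      have k6 := hf a b _ _ h2 g6 hab
      have k7 := hf a b _ _ h3 g7 hab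
      refine ⟨⟨m _ g0, m _ g1, m _ g2, m _ g3, k4.1, k5.1, k6.1, k7.1⟩, fun S => ?_⟩
      show s.sm (sel s.top S b0 b1 b2 b3 (f a0 b4) (f a1 b5) (f a2 b6) (f a3 b7)) S =
        (if s.top + 3 ∈ S then s.sm (sel s.top (S.erase (s.top + 3)) a0 a1 a2 a3 a4 a5 a6 a7)
          (S.erase (s.top + 3)) else 0) + s.sm (sel s.top S b0 b1 b2 b3 b4 b5 b6 b7) S
      rw [hl]
      unfold sel
      simp only [idF] at k4 k5 k6 k7
      by_cases c1 : s.top + 1 ∈ S <;> by_cases c2 : s.top + 2 ∈ S <;> by_cases c3 : s.top + 3 ∈ S <;>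
        simp [c1, c2, c3, k4, k5, k6, k7]


theorem ins1_spec (s : Sem α) (f : α → α → α) (hf : Impl s f idF) :
    Impl (Sem8 s) (ins1 α f s.zz) (eF (s.top + 2)) := by
  intro a b t u ht hu hab
  cases t with
  | z =>
    refine ⟨(Sem8 s).mono b (a + b) u (by omega) hu, fun S => ?_⟩
    have : eF (s.top + 2) ((Sem8 s).sm .z) S = 0 := by simp [eF, Sem8, sm8]
    rw [this, Nat.zero_add]; rfl
  | n a0 a1 a2 a3 a4 a5 a6 a7 =>
    obtain ⟨h0, h1, h2, h3, h4, h5, h6, h7⟩ := ht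
    have hl : ∀ S x, s.sm x (S.erase (s.top + 2)) = s.sm x S :=
      fun S x => s.loc x S _ (by omega)
    cases u with
    | z =>
      have m := fun x (h : s.bd a x) => s.mono a (a + b) x (by omega) h
      have zb := s.zbd (a + b)
      refine ⟨⟨zb, zb, m _ h0, m _ h1, zb, zb, m _ h4, m _ h5⟩, fun S => ?_⟩
      show s.sm (sel s.top S s.zz s.zz a0 a1 s.zz s.zz a4 a5) S =
        (if s.top + 2 ∈ S then s.sm (sel s.top (S.erase (s.top + 2)) a0 a1 a2 a3 a4 a5 a6 a7)
          (S.erase (s.top + 2)) else 0) + 0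
      rw [hl]
      unfold sel
      by_cases c1 : s.top + 1 ∈ S <;> by_cases c2 : s.top + 2 ∈ S <;> by_cases c3 : s.top + 3 ∈ S <;>
        simp [c1, c2, c3, s.zsm]
    | n b0 b1 b2 b3 b4 b5 b6 b7 =>
      obtain ⟨g0, g1, g2, g3, g4, g5, g6, g7⟩ := hu
      have m := fun x (h : s.bd b x) => s.mono b (a + b) x (by omega) h
      have k2 := hf a b _ _ h0 g2 hab
      have k3 := hf a b _ _ h1 g3 hab
      have k6 := hf a b _ _ h4 g6 hab
      have k7 := hf a b _ _ h5 g7 hab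
      refine ⟨⟨m _ g0, m _ g1, k2.1, k3.1, m _ g4, m _ g5, k6.1, k7.1⟩, fun S => ?_⟩
      show s.sm (sel s.top S b0 b1 (f a0 b2) (f a1 b3) b4 b5 (f a4 b6) (f a5 b7)) S =
        (if s.top + 2 ∈ S then s.sm (sel s.top (S.erase (s.top + 2)) a0 a1 a2 a3 a4 a5 a6 a7)
          (S.erase (s.top + 2)) else 0) + s.sm (sel s.top S b0 b1 b2 b3 b4 b5 b6 b7) S
      rw [hl]
      unfold sel
      simp only [idF] at k2 k3 k6 k7
      by_cases c1 : s.top + 1 ∈ S <;> by_cases c2 : s.top + 2 ∈ S <;> by_cases c3 : s.top + 3 ∈ S <;>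
        simp [c1, c2, c3, k2, k3, k6, k7]


theorem ins2_spec (s : Sem α) (f : α → α → α) (hf : Impl s f idF) :
    Impl (Sem8 s) (ins2 α f s.zz) (eF (s.top + 1)) := by
  intro a b t u ht hu hab
  cases t with
  | z =>
    refine ⟨(Sem8 s).mono b (a + b) u (by omega) hu, fun S => ?_⟩
    have : eF (s.top + 1) ((Sem8 s).sm .z) S = 0 := by simp [eF, Sem8, sm8]
    rw [this, Nat.zero_add]; rfl
  | n a0 a1 a2 a3 a4 a5 a6 a7 =>
    obtain ⟨h0, h1, h2, h3, h4, h5, h6, h7⟩ := ht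
    have hl : ∀ S x, s.sm x (S.erase (s.top + 1)) = s.sm x S :=
      fun S x => s.loc x S _ (by omega)
    cases u with
    | z =>
      have m := fun x (h : s.bd a x) => s.mono a (a + b) x (by omega) h
      have zb := s.zbd (a + b)
      refine ⟨⟨zb, m _ h0, zb, m _ h2, zb, m _ h4, zb, m _ h6⟩, fun S => ?_⟩
      show s.sm (sel s.top S s.zz a0 s.zz a2 s.zz a4 s.zz a6) S =
        (if s.top + 1 ∈ S then s.sm (sel s.top (S.erase (s.top + 1)) a0 a1 a2 a3 a4 a5 a6 a7)
          (S.erase (s.top + 1)) else 0) + 0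
      rw [hl]
      unfold sel
      by_cases c1 : s.top + 1 ∈ S <;> by_cases c2 : s.top + 2 ∈ S <;> by_cases c3 : s.top + 3 ∈ S <;>
        simp [c1, c2, c3, s.zsm]
    | n b0 b1 b2 b3 b4 b5 b6 b7 =>
      obtain ⟨g0, g1, g2, g3, g4, g5, g6, g7⟩ := hu
      have m := fun x (h : s.bd b x) => s.mono b (a + b) x (by omega) h
      have k1 := hf a b _ _ h0 g1 hab
      have k3 := hf a b _ _ h2 g3 hab
      have k5 := hf a b _ _ h4 g5 hab
      have k7 := hf a b _ _ h6 g7 hab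
      refine ⟨⟨m _ g0, k1.1, m _ g2, k3.1, m _ g4, k5.1, m _ g6, k7.1⟩, fun S => ?_⟩
      show s.sm (sel s.top S b0 (f a0 b1) b2 (f a2 b3) b4 (f a4 b5) b6 (f a6 b7)) S =
        (if s.top + 1 ∈ S then s.sm (sel s.top (S.erase (s.top + 1)) a0 a1 a2 a3 a4 a5 a6 a7)
          (S.erase (s.top + 1)) else 0) + s.sm (sel s.top S b0 b1 b2 b3 b4 b5 b6 b7) S
      rw [hl]
      unfold sel
      simp only [idF] at k1 k3 k5 k7
      by_cases c1 : s.top + 1 ∈ S <;> by_cases c2 : s.top + 2 ∈ S <;> by_cases c3 : s.top + 3 ∈ S <;>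
        simp [c1, c2, c3, k1, k3, k5, k7]


theorem eF_hF (k e : ℕ) (he : e ≤ k) (g g' : Finset ℕ → ℕ) (S : Finset ℕ)
    (h : ∀ S', (∀ j, k < j → (j ∈ S' ↔ j ∈ S)) → g S' = g' S') : eF e g S = eF e g' S := by
  unfold eF
  rw [h]
  intro j hj; simp; omega

theorem eF_hF0 (e : ℕ) (S : Finset ℕ) : eF e (fun _ => 0) S = 0 := by simp [eF]

abbrev Sem1 := Sem8 Sem0
abbrev Sem2 := Sem8 Sem1
abbrev Sem3 := Sem8 Sem2

theorem A1_spec : Impl Sem1 A1 idF := add_spec Sem0 addL addL_spec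
theorem A2_spec : Impl Sem2 A2 idF := add_spec Sem1 A1 A1_spec
theorem M3_spec (p : ℕ) : Impl Sem3 (M3 p 0) (mF 24 p 0) :=
  addc_spec Sem2 (M2 p) p (fun c => addc_spec Sem1 (M1 p) p
    (fun c => addc_spec Sem0 (addML p) p (addML_spec p) c) c) 0
theorem I3_spec (e : ℕ) (he : e < 15) :
    Impl Sem3 (I3 (msk e) (Nat.mul 8 (Nat.pow 2 e))) (eF (e + 1)) :=
  addz_spec Sem2 _ _ (addz_spec Sem1 _ _ (addz_spec Sem0 _ _ (addIL_spec e he)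
    (eF_hF 15 _ (by omega)) (eF_hF0 _)) (eF_hF 18 _ (by omega)) (eF_hF0 _))
    (eF_hF 21 _ (by omega)) (eF_hF0 _)

theorem E3_spec (q : ℕ) (hq : q < 9) : Impl Sem3 (E3 q) (eF (24 - q)) := by
  have a1 := A1_spec
  have a2 := A2_spec
  have lift1 : ∀ q < 3, Impl Sem1 (E1 q) (eF (18 - q)) → Impl Sem3 (E3 (q + 6)) (eF (24 - (q + 6))) := by
    intro q hq h
    have e : 24 - (q + 6) = 18 - q := by omega
    rw [e]
    exact addz_spec Sem2 _ _ (addz_spec Sem1 _ _ h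
      (eF_hF 18 _ (by omega)) (eF_hF0 _)) (eF_hF 21 _ (by omega)) (eF_hF0 _)
  have lift2 : ∀ q < 3, Impl Sem2 (E2 q) (eF (21 - q)) → Impl Sem3 (E3 (q + 3)) (eF (24 - (q + 3))) := by
    intro q hq h
    have e : 24 - (q + 3) = 21 - q := by omega
    rw [e]
    exact addz_spec Sem2 _ _ h (eF_hF 21 _ (by omega)) (eF_hF0 _)
  interval_cases q
  · exact ins0_spec Sem2 _ a2
  · exact ins1_spec Sem2 _ a2
  · exact ins2_spec Sem2 _ a2
  · exact lift2 0 (by omega) (ins0_spec Sem1 _ a1)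
  · exact lift2 1 (by omega) (ins1_spec Sem1 _ a1)
  · exact lift2 2 (by omega) (ins2_spec Sem1 _ a1)
  · exact lift1 0 (by omega) (ins0_spec Sem0 _ addL_spec)
  · exact lift1 1 (by omega) (ins1_spec Sem0 _ addL_spec)
  · exact lift1 2 (by omega) (ins2_spec Sem0 _ addL_spec)

def insF (p e : ℕ) : Op := fun g S =>
  if e = 0 then (if cnt 24 S = p then g S else 0) else if e ∈ S then g (S.erase e) else 0

theorem addE_spec (p e : ℕ) (he : e ≤ 24) : Impl Sem3 (addE p e) (insF p e) := by
  by_cases h : e ≤ 15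
  · have hb := Nat.ble_eq_true_of_le h
    cases e with
    | zero =>
      have h1 : insF p 0 = mF 24 p 0 := by funext g S; simp [insF, mF]
      rw [h1]; exact M3_spec p
    | succ e =>
      have h1 : insF p (e + 1) = eF (e + 1) := by funext g S; simp [insF, eF]
      have h2 : addE p (e + 1) = I3 (msk e) (Nat.mul 8 (Nat.pow 2 e)) := by
        unfold addE; rw [hb]
      rw [h1, h2]; exact I3_spec e (by omega)
  · have h1 : insF p e = eF e := by funext g S; simp [insF, eF]; omega
    have hb : Nat.ble e 15 = false := by
      cases hh : Nat.ble e 15 with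
      | false => rfl
      | true => exact absurd (Nat.le_of_ble_eq_true hh) h
    have h2 : addE p e = E3 (24 - e) := by unfold addE; rw [hb]; rfl
    have h3 := E3_spec (24 - e) (by omega)
    rw [h1, h2]
    have h4 : 24 - (24 - e) = e := by omega
    rw [h4] at h3; exact h3
end EM

namespace EM
variable {α : Type}
theorem and'_true {a b : Bool} (h : and' a b = true) : a = true ∧ b = true := by
  cases a <;> cases b <;> simp_all [and']

def NmOk (s : Sem α) (f : α → α) : Prop :=
  ∀ t, (∀ b, s.bd b t → s.bd b (f t)) ∧ ∀ S, s.sm (f t) S = s.sm t S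
def IzOk (s : Sem α) (iz : α → Bool) : Prop := ∀ t, iz t = true → t = s.zz

theorem nm0_ok : NmOk Sem0 nm0 := by
  intro t
  cases t with
  | z => exact ⟨fun b h => h, fun S => rfl⟩
  | lf N =>
    cases h : Nat.beq N 0 with
    | false =>
      have e : nm0 (.lf N) = .lf N := by
        show Bool.rec (motive := fun _ => L) _ _ (Nat.beq N 0) = _
        rw [h]
      rw [e]; exact ⟨fun b h => h, fun S => rfl⟩
    | true =>
      have hN := Nat.eq_of_beq_eq_true h
      have e : nm0 (.lf N) = .z := by
        show Bool.rec (motive := fun _ => L) _ _ (Nat.beq N 0) = _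
        rw [h]
      rw [e]
      refine ⟨fun b h => trivial, fun S => ?_⟩
      subst hN
      exact (dig_zero _).symm

theorem isz0_ok : IzOk Sem0 isz0 := by
  intro t h
  cases t with
  | z => rfl
  | lf N => cases h

theorem isz_ok (s : Sem α) : IzOk (Sem8 s) (isz α) := by
  intro t h
  cases t with
  | z => rfl
  | n => cases h

theorem nm_ok (s : Sem α) (iz : α → Bool) (f : α → α) (hz : IzOk s iz) (hf : NmOk s f) :
    NmOk (Sem8 s) (nm α iz f) := by
  intro t
  cases t with
  | z => exact ⟨fun b h => h, fun S => rfl⟩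
  | n a0 a1 a2 a3 a4 a5 a6 a7 =>
    have hs : ∀ S, s.sm (sel s.top S (f a0) (f a1) (f a2) (f a3) (f a4) (f a5) (f a6) (f a7)) S =
        s.sm (sel s.top S a0 a1 a2 a3 a4 a5 a6 a7) S := by
      intro S
      rw [← sel_map f]; exact (hf _).2 S
    cases h : (and' (iz (f a0)) (and' (iz (f a1)) (and' (iz (f a2)) (and' (iz (f a3)) (and' (iz (f a4))
      (and' (iz (f a5)) (and' (iz (f a6)) (iz (f a7))))))))) with
    | false =>
      have e : nm α iz f (.n a0 a1 a2 a3 a4 a5 a6 a7) =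
          .n (f a0) (f a1) (f a2) (f a3) (f a4) (f a5) (f a6) (f a7) := by
        show nm1 α iz _ _ _ _ _ _ _ _ = _
        unfold nm1; rw [h]
      rw [e]
      refine ⟨fun b hb => ?_, hs⟩
      obtain ⟨h0, h1, h2, h3, h4, h5, h6, h7⟩ := hb
      exact ⟨(hf _).1 b h0, (hf _).1 b h1, (hf _).1 b h2, (hf _).1 b h3, (hf _).1 b h4,
        (hf _).1 b h5, (hf _).1 b h6, (hf _).1 b h7⟩
    | true =>
      have e : nm α iz f (.n a0 a1 a2 a3 a4 a5 a6 a7) = .z := by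
        show nm1 α iz _ _ _ _ _ _ _ _ = _
        unfold nm1; rw [h]
      rw [e]
      refine ⟨fun b hb => trivial, fun S => ?_⟩
      show 0 = s.sm _ S
      rw [← hs]
      obtain ⟨h0, h⟩ := and'_true h
      obtain ⟨h1, h⟩ := and'_true h
      obtain ⟨h2, h⟩ := and'_true h
      obtain ⟨h3, h⟩ := and'_true h
      obtain ⟨h4, h⟩ := and'_true h
      obtain ⟨h5, h⟩ := and'_true h
      obtain ⟨h6, h7⟩ := and'_true h
      rw [hz _ h0, hz _ h1, hz _ h2, hz _ h3, hz _ h4, hz _ h5, hz _ h6, hz _ h7]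
      unfold sel; split_ifs <;> exact (s.zsm S).symm

theorem norm_ok : NmOk Sem3 norm :=
  nm_ok Sem2 _ _ (isz_ok Sem1) (nm_ok Sem1 _ _ (isz_ok Sem0) (nm_ok Sem0 _ _ isz0_ok nm0_ok))

def CkOk (s : Sem α) (f : α → Bool) : Prop := ∀ t, f t = true → s.bd 250 t → s.bd 10 t

set_option maxRecDepth 10000 in
theorem land240 : ∀ x < 256, x &&& 240 = 0 → x < 16 := by decide

theorem ck0_ok : CkOk Sem0 ck0 := by
  intro t h hb
  cases t with
  | z => trivial
  | lf N =>
    have h1 : Nat.land (N + c5) c240 = 0 := Nat.eq_of_beq_eq_true h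
    obtain ⟨hN, hZ⟩ := hb
    refine ⟨fun i => ?_, hZ⟩
    by_cases hi : i < 2 ^ 15
    · obtain ⟨z5, d5⟩ := cst_spec 5 (by norm_num)
      have d240 := (cst_spec 240 (by norm_num)).2 i hi
      have hadd := dig_add N (cst 5) (fun j => by
        have h1 : dig N j ≤ 250 := hN j
        by_cases hj : j < 2 ^ 15
        · rw [d5 j hj]; omega
        · rw [z5 j (by omega)]; omega) i
      have h2 : dig (Nat.land (N + c5) c240) i = 0 := by rw [h1, dig_zero]
      rw [dig_land] at h2
      have h3 : dig (N + c5) i &&& 240 = 0 := by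
        rw [← h2]; congr 1; exact d240.symm
      have h4 : dig (N + c5) i = dig N i + 5 := by rw [← d5 i hi]; exact hadd
      have h5 := dig_le (N + c5) i
      have := land240 _ (by omega) h3
      omega
    · rw [hZ i (by omega)]; omega

theorem ck_ok (s : Sem α) (f : α → Bool) (hf : CkOk s f) : CkOk (Sem8 s) (ck α f) := by
  intro t h hb
  cases t with
  | z => trivial
  | n a0 a1 a2 a3 a4 a5 a6 a7 =>
    obtain ⟨k0, k1, k2, k3, k4, k5, k6, k7⟩ := hb
    have h : (and' (f a0) (and' (f a1) (and' (f a2) (and' (f a3) (and' (f a4) (and' (f a5) (and' (f a6) (f a7)))))))) = true := h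
    obtain ⟨h0, h⟩ := and'_true h
    obtain ⟨h1, h⟩ := and'_true h
    obtain ⟨h2, h⟩ := and'_true h
    obtain ⟨h3, h⟩ := and'_true h
    obtain ⟨h4, h⟩ := and'_true h
    obtain ⟨h5, h⟩ := and'_true h
    obtain ⟨h6, h7⟩ := and'_true h
    exact ⟨hf _ h0 k0, hf _ h1 k1, hf _ h2 k2, hf _ h3 k3, hf _ h4 k4, hf _ h5 k5, hf _ h6 k6, hf _ h7 k7⟩

theorem chk_ok : CkOk Sem3 chk := ck_ok Sem2 _ (ck_ok Sem1 _ (ck_ok Sem0 _ ck0_ok))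

theorem chkL_ok (G : List T3) (h : chkL G = true) : ∀ t ∈ G, chk t = true := by
  induction G with
  | nil => simp
  | cons t G ih =>
    have h : and' (chk t) (chkL G) = true := h
    obtain ⟨h1, h2⟩ := and'_true h
    intro u hu
    rcases List.mem_cons.1 hu with rfl | hu
    · exact h1
    · exact ih h2 u hu

/-! ### Families of lists -/
def ext (e : ℕ) (F : Finset (List ℕ)) : Finset (List ℕ) :=
  (F.filter (fun l => e ∉ l)).image (fun l => e :: l)
def tab (F : Finset (List ℕ)) (S : Finset ℕ) : ℕ :=
  (F.filter (fun l => l.toFinset.erase 0 = S)).card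
def WF (p : ℕ) (F : Finset (List ℕ)) : Prop :=
  ∀ l ∈ F, l.Nodup ∧ l.length = p ∧ ∀ a ∈ l, a ≤ 24

theorem mem_ext {e : ℕ} {F : Finset (List ℕ)} {l : List ℕ} :
    l ∈ ext e F ↔ ∃ l' ∈ F, e ∉ l' ∧ l = e :: l' := by
  simp only [ext, Finset.mem_image, Finset.mem_filter]
  constructor
  · rintro ⟨a, ⟨h1, h2⟩, rfl⟩; exact ⟨a, h1, h2, rfl⟩
  · rintro ⟨a, h1, h2, rfl⟩; exact ⟨a, ⟨h1, h2⟩, rfl⟩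

theorem WF_ext {p e : ℕ} (he : e ≤ 24) {F : Finset (List ℕ)} (h : WF p F) : WF (p + 1) (ext e F) := by
  intro l hl
  obtain ⟨l', h1, h2, rfl⟩ := mem_ext.1 hl
  obtain ⟨h3, h4, h5⟩ := h l' h1
  refine ⟨List.nodup_cons.2 ⟨h2, h3⟩, by simp [h4], ?_⟩
  intro a ha
  rcases List.mem_cons.1 ha with rfl | ha
  · exact he
  · exact h5 a ha

abbrev Om : Finset ℕ := Finset.Icc 1 24

theorem cnt_card (k : ℕ) (S : Finset ℕ) : cnt k S = (S ∩ Finset.Icc 1 k).card := by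
  induction k with
  | zero => simp [cnt]
  | succ k ih =>
    rw [cnt, ih, ← Finset.insert_Icc_right_eq_Icc_add_one (by omega)]
    by_cases h : k + 1 ∈ S
    · rw [Finset.inter_insert_of_mem h, Finset.card_insert_of_notMem (by simp)]; simp [h]
    · rw [Finset.inter_insert_of_notMem h]; simp [h]

theorem tab_ext {p e : ℕ} {F : Finset (List ℕ)} (hF : WF p F) {S : Finset ℕ} (hS : S ⊆ Om) :
    tab (ext e F) S = insF p e (tab F) S := by
  have h1 : tab (ext e F) S = (F.filter (fun l => e ∉ l ∧ (insert e l.toFinset).erase 0 = S)).card := by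
    unfold tab ext
    rw [Finset.filter_image, Finset.card_image_of_injective, Finset.filter_filter]
    · simp only [List.toFinset_cons]
    · intro a b h; simpa using h
  rw [h1]
  unfold insF
  by_cases he : e = 0
  · subst he
    have hc : cnt 24 S = S.card := by rw [cnt_card, Finset.inter_eq_left.2 hS]
    rw [if_pos rfl, hc]
    split_ifs with hp
    · unfold tab
      congr 1
      apply Finset.filter_congr
      intro l hl
      obtain ⟨h2, h3, h4⟩ := hF l hl
      have hcard : l.toFinset.card = p := by rw [List.toFinset_card_of_nodup h2, h3]
      rw [Finset.erase_insert_eq_erase]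
      constructor
      · exact fun h => h.2
      · intro h
        refine ⟨fun h0 => ?_, h⟩
        have := Finset.card_erase_of_mem (List.mem_toFinset.2 h0)
        have h5 : l.toFinset.card > 0 := Finset.card_pos.2 ⟨0, List.mem_toFinset.2 h0⟩
        rw [h] at this; omega
    · rw [Finset.card_eq_zero, Finset.filter_eq_empty_iff]
      rintro l hl ⟨h5, h6⟩
      obtain ⟨h2, h3, h4⟩ := hF l hl
      have hcard : l.toFinset.card = p := by rw [List.toFinset_card_of_nodup h2, h3]
      rw [Finset.erase_insert (by simpa using h5)] at h6
      rw [h6] at hcard; exact hp hcard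
  · rw [if_neg he]
    split_ifs with hp
    · unfold tab
      congr 1
      apply Finset.filter_congr
      intro l hl
      rw [Finset.erase_insert_of_ne he]
      constructor
      · rintro ⟨h2, rfl⟩
        rw [Finset.erase_insert]
        simp [h2]
      · intro h
        refine ⟨fun h2 => ?_, ?_⟩
        · have : e ∈ S.erase e := by rw [← h]; simp [he, h2]
          simp at this
        · rw [h, Finset.insert_erase hp]
    · rw [Finset.card_eq_zero, Finset.filter_eq_empty_iff]
      rintro l hl ⟨h5, rfl⟩
      apply hp; simp [he]
end EM

namespace EM
def Rel (b p : ℕ) (t : T3) (F : Finset (List ℕ)) : Prop :=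
  Sem3.bd b t ∧ WF p F ∧ ∀ S, S ⊆ Om → Sem3.sm t S = tab F S

theorem tab_union {A B : Finset (List ℕ)} (h : Disjoint A B) (S : Finset ℕ) :
    tab (A ∪ B) S = tab A S + tab B S := by
  unfold tab
  rw [Finset.filter_union, Finset.card_union_of_disjoint]
  exact Finset.disjoint_filter_filter h

theorem insF_congr {p e : ℕ} {f g : Finset ℕ → ℕ} (h : ∀ S, S ⊆ Om → f S = g S) {S : Finset ℕ}
    (hS : S ⊆ Om) : insF p e f S = insF p e g S := by
  unfold insF
  rw [h S hS, h (S.erase e) ((Finset.erase_subset _ _).trans hS)]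

theorem addE_rel {p e a b : ℕ} {t u : T3} {F H : Finset (List ℕ)} (he : e ≤ 24)
    (ht : Rel a p t F) (hu : Rel b (p + 1) u H) (hab : a + b ≤ 255) (hd : Disjoint (ext e F) H) :
    Rel (a + b) (p + 1) (addE p e t u) (ext e F ∪ H) := by
  obtain ⟨t1, t2, t3⟩ := ht
  obtain ⟨u1, u2, u3⟩ := hu
  obtain ⟨h1, h2⟩ := addE_spec p e he a b t u t1 u1 hab
  refine ⟨h1, ?_, fun S hS => ?_⟩
  · intro l hl
    rcases Finset.mem_union.1 hl with hl | hl
    · exact WF_ext he t2 l hl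
    · exact u2 l hl
  · rw [h2, tab_union hd, tab_ext t2 hS, u3 S hS, insF_congr t3 hS]

theorem rel_empty (b p : ℕ) : Rel b p .z ∅ := by
  refine ⟨trivial, ?_, ?_⟩
  · intro l hl; simp at hl
  · intro S _; rfl

def Ux (tst : ℕ → ℕ → Bool) (s : ℕ) (Φ : ℕ → Finset (List ℕ)) (x : ℕ) : Finset (List ℕ) :=
  if x ≤ s ∧ tst (s - x) x = true then ext (s - x) (Φ x) else ∅
def Uf (tst : ℕ → ℕ → Bool) (s : ℕ) (Φ : ℕ → Finset (List ℕ)) : Finset (List ℕ) :=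
  (Finset.range 25).biUnion (Ux tst s Φ)
def nxt (tst : ℕ → ℕ → Bool) (K : ℕ) (Φ : ℕ → Finset (List ℕ)) (v : ℕ) : Finset (List ℕ) :=
  ext v (Uf tst (K - v) Φ)

def TstOk (tst : ℕ → ℕ → Bool) : Prop := ∀ e x, x < 25 → tst e x = true → e ≤ 24
def HdOk (Φ : ℕ → Finset (List ℕ)) : Prop := ∀ x, ∀ l ∈ Φ x, ∃ l', l = x :: l'

theorem sumU_rel {tst : ℕ → ℕ → Bool} (htst : TstOk tst) {p s : ℕ} {Φ : ℕ → Finset (List ℕ)}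
    (hΦ : HdOk Φ) (G : List T3) (x0 : ℕ) (hx : x0 + G.length = 25)
    (hG : ∀ i t, G[i]? = some t → Rel 10 p t (Φ (x0 + i))) :
    Rel (10 * G.length) (p + 1) (sumU tst p s G x0)
      ((Finset.Ico x0 25).biUnion (Ux tst s Φ)) := by
  induction G generalizing x0 with
  | nil =>
    simp at hx
    subst hx
    simp only [Finset.Ico_self, Finset.biUnion_empty]
    exact rel_empty _ _
  | cons t G ih =>
    simp only [List.length_cons] at hx
    have ih := ih (x0 + 1) (by omega) (fun i t h => by
      have := hG (i + 1) t (by simpa using h)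
      rwa [show x0 + 1 + i = x0 + (i + 1) by omega])
    have ht : Rel 10 p t (Φ x0) := hG 0 t (by simp)
    have e1 : Finset.Ico x0 25 = insert x0 (Finset.Ico (x0 + 1) 25) :=
      (Finset.insert_Ico_add_one_left_eq_Ico (by omega)).symm
    rw [e1, Finset.biUnion_insert]
    have hlen : 10 * (t :: G).length = 10 + 10 * G.length := by simp; ring
    rw [hlen]
    cases hc : and' (Nat.ble x0 s) (tst (Nat.sub s x0) x0) with
    | false =>
      have e2 : sumU tst p s (t :: G) x0 = sumU tst p s G (x0 + 1) := by
        show Bool.rec (motive := fun _ => T3) _ _ (and' (Nat.ble x0 s) (tst (Nat.sub s x0) x0)) = _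
        rw [hc]; rfl
      have e3 : Ux tst s Φ x0 = ∅ := by
        unfold Ux
        rw [if_neg]
        rintro ⟨h1, h2⟩
        rw [Nat.ble_eq_true_of_le h1] at hc
        change tst (s - x0) x0 = false at hc
        rw [hc] at h2; cases h2
      rw [e2, e3, Finset.empty_union]
      exact ⟨Sem3.mono _ _ _ (by omega) ih.1, ih.2⟩
    | true =>
      have e2 : sumU tst p s (t :: G) x0 = addE p (s - x0) t (sumU tst p s G (x0 + 1)) := by
        show Bool.rec (motive := fun _ => T3) _ _ (and' (Nat.ble x0 s) (tst (Nat.sub s x0) x0)) = _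
        rw [hc]; rfl
      obtain ⟨h1, h2⟩ := and'_true hc
      have h1 := Nat.le_of_ble_eq_true h1
      have h2 : tst (s - x0) x0 = true := h2
      have e3 : Ux tst s Φ x0 = ext (s - x0) (Φ x0) := if_pos ⟨h1, h2⟩
      rw [e2, e3]
      apply addE_rel (htst _ _ (by omega) h2) ht ih (by omega)
      rw [Finset.disjoint_left]
      intro l hl hl2
      obtain ⟨l1, a1, a2, rfl⟩ := mem_ext.1 hl
      obtain ⟨x, hx1, hx2⟩ := Finset.mem_biUnion.1 hl2
      unfold Ux at hx2
      split_ifs at hx2 with hc2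
      · obtain ⟨l2, b1, b2, b3⟩ := mem_ext.1 hx2
        obtain ⟨m1, rfl⟩ := hΦ _ _ a1
        obtain ⟨m2, rfl⟩ := hΦ _ _ b1
        simp at b3
        simp at hx1
        omega
      · simp at hx2

def GRel (b p : ℕ) (G : List T3) (Φ : ℕ → Finset (List ℕ)) : Prop :=
  G.length = 25 ∧ HdOk Φ ∧ ∀ i t, G[i]? = some t → Rel b p t (Φ i)

theorem GRel_chk {p : ℕ} {G : List T3} {Φ : ℕ → Finset (List ℕ)} (h : GRel 250 p G Φ)
    (hc : chkL G = true) : GRel 10 p G Φ := by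
  refine ⟨h.1, h.2.1, fun i t hi => ?_⟩
  have := h.2.2 i t hi
  exact ⟨chk_ok t (chkL_ok G hc t (List.mem_of_getElem? hi)) this.1, this.2⟩

theorem sumU_rel' {tst : ℕ → ℕ → Bool} (htst : TstOk tst) {p s : ℕ} {Φ : ℕ → Finset (List ℕ)}
    {G : List T3} (h : GRel 10 p G Φ) : Rel 250 (p + 1) (sumU tst p s G 0) (Uf tst s Φ) := by
  have := sumU_rel htst h.2.1 G (s := s) 0 (by have := h.1; omega) (fun i t hi => by
    rw [Nat.zero_add]; exact h.2.2 i t hi)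
  rw [h.1] at this
  unfold Uf
  rwa [Finset.range_eq_Ico]

theorem mkG_eq (tst : ℕ → ℕ → Bool) (p K : ℕ) (G : List T3) (l : List ℕ) :
    mkG tst p K G l =
      l.map (fun v => norm (addE (p + 1) v (sumU tst p (K - v) G 0) .z)) := by
  induction l with
  | nil => rfl
  | cons v l ih => rw [List.map_cons, ← ih]; rfl

theorem vs_eq : vs = List.range 25 := by decide

theorem addE_z_rel {p e b : ℕ} {t : T3} {F : Finset (List ℕ)} (he : e ≤ 24)
    (ht : Rel b p t F) (hb : b ≤ 255) : Rel b (p + 1) (addE p e t .z) (ext e F) := by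
  have := addE_rel he ht (rel_empty 0 (p + 1)) (by omega) (by simp)
  simpa using this

theorem nxt_hd (tst : ℕ → ℕ → Bool) (K : ℕ) (Φ : ℕ → Finset (List ℕ)) : HdOk (nxt tst K Φ) := by
  intro x l hl
  obtain ⟨l', _, _, h⟩ := mem_ext.1 hl
  exact ⟨l', h⟩

theorem mkG_rel {tst : ℕ → ℕ → Bool} (htst : TstOk tst) {p K : ℕ} {Φ : ℕ → Finset (List ℕ)}
    {G : List T3} (h : GRel 10 p G Φ) : GRel 250 (p + 2) (mkG tst p K G vs) (nxt tst K Φ) := by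
  rw [mkG_eq, vs_eq]
  refine ⟨by simp, nxt_hd _ _ _, fun i t hi => ?_⟩
  simp only [List.getElem?_map, Option.map_eq_some_iff] at hi
  obtain ⟨v, hv, rfl⟩ := hi
  obtain ⟨hv1, rfl⟩ : i < 25 ∧ i = v := by
    rw [List.getElem?_eq_some_iff] at hv
    obtain ⟨h1, h2⟩ := hv
    simp at h1 h2
    exact ⟨h1, h2⟩
  have := addE_z_rel (e := i) (by omega) (sumU_rel' htst h (s := K - i)) (by omega)
  exact ⟨(norm_ok _).1 _ this.1, this.2.1, fun S hS => by rw [(norm_ok _).2, this.2.2 S hS]; rfl⟩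

theorem unit_rel : Rel 10 0 unit {[]} := by
  refine ⟨?_, ?_, ?_⟩
  · have h1 : bd0 10 (.lf 1) := by
      have hd : ∀ i, dig 1 i = if i = 0 then 1 else 0 := by
        intro i
        unfold dig
        split_ifs with h
        · subst h; norm_num
        · rw [Nat.div_eq_of_lt (Nat.one_lt_pow h (by norm_num))]
      refine ⟨fun i => ?_, fun i hi => ?_⟩
      · rw [hd]; split_ifs <;> omega
      · rw [hd, if_neg]
        rintro rfl; simp at hi
    exact ⟨⟨⟨h1, trivial, trivial, trivial, trivial, trivial, trivial, trivial⟩,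
      trivial, trivial, trivial, trivial, trivial, trivial, trivial⟩,
      trivial, trivial, trivial, trivial, trivial, trivial, trivial⟩
  · intro l hl
    simp at hl; subst hl; simp
  · intro S hS
    have h1 : tab {[]} S = if S = ∅ then 1 else 0 := by
      by_cases h : S = ∅
      · subst h; rfl
      · rw [if_neg h]
        unfold tab
        rw [Finset.card_eq_zero, Finset.filter_eq_empty_iff]
        intro x hx hx2
        rw [Finset.mem_singleton] at hx
        subst hx
        exact h (by simpa using hx2.symm)
    rw [h1]
    by_cases hE : S = ∅
    · subst hE; rw [if_pos rfl]
      show dig 1 (idx 15 ∅) = 1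
      have : ∀ k, idx k ∅ = 0 := by
        intro k
        induction k with
        | zero => rfl
        | succ k ih => rw [idx, ih]; simp
      rw [this]; rfl
    · rw [if_neg hE]
      have hz : ∀ (α : Type) (s : Sem α) (a : α) (S : Finset ℕ) (k : ℕ) , s.sm a S = 0 →
          s.sm (sel k S a s.zz s.zz s.zz s.zz s.zz s.zz s.zz) S = 0 := by
        intro α s a S k h
        unfold sel; split_ifs <;> first | exact h | exact s.zsm S
      have hz2 : ∀ (α : Type) (s : Sem α) (a : α) (S : Finset ℕ) (k : ℕ),
          (k + 1 ∈ S ∨ k + 2 ∈ S ∨ k + 3 ∈ S) →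
          s.sm (sel k S a s.zz s.zz s.zz s.zz s.zz s.zz s.zz) S = 0 := by
        intro α s a S k h
        unfold sel; split_ifs <;> first | exact s.zsm S | (exfalso; tauto)
      by_cases g3 : 22 ∈ S ∨ 23 ∈ S ∨ 24 ∈ S
      · exact hz2 _ Sem2 _ S 21 g3
      · refine hz _ Sem2 _ S 21 ?_
        by_cases g2 : 19 ∈ S ∨ 20 ∈ S ∨ 21 ∈ S
        · exact hz2 _ Sem1 _ S 18 g2
        · refine hz _ Sem1 _ S 18 ?_
          by_cases g1 : 16 ∈ S ∨ 17 ∈ S ∨ 18 ∈ S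
          · exact hz2 _ Sem0 _ S 15 g1
          · refine hz _ Sem0 _ S 15 ?_
            show dig 1 (idx 15 S) = 0
            obtain ⟨e, he⟩ := Finset.nonempty_iff_ne_empty.2 hE
            have he2 := hS he
            simp only [Finset.mem_Icc] at he2
            have he3 : e ≤ 15 := by
              by_contra h
              push Not at g1 g2 g3
              have : e = 16 ∨ e = 17 ∨ e = 18 ∨ e = 19 ∨ e = 20 ∨ e = 21 ∨ e = 22 ∨ e = 23 ∨ e = 24 := by omega
              rcases this with rfl | rfl | rfl | rfl | rfl | rfl | rfl | rfl | rfl <;> tauto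
            have h4 := idx_erase 15 S (e - 1) (by omega) (by rwa [Nat.sub_add_cancel he2.1])
            have h5 : 0 < idx 15 S := by
              rw [← h4]; have := Nat.two_pow_pos (e - 1); omega
            unfold dig
            rw [Nat.div_eq_of_lt (Nat.one_lt_pow (by omega) (by norm_num))]

def Φ0 (v : ℕ) : Finset (List ℕ) := ext v {[]}

theorem G0_eq (l : List ℕ) : G0 l = l.map (fun v => addE 0 v unit .z) := by
  induction l with
  | nil => rfl
  | cons v l ih => rw [List.map_cons, ← ih]; rfl

theorem G0_rel : GRel 250 1 (G0 vs) Φ0 := by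
  rw [G0_eq, vs_eq]
  refine ⟨by simp, ?_, fun i t hi => ?_⟩
  · intro x l hl
    obtain ⟨l', _, _, h⟩ := mem_ext.1 hl
    exact ⟨l', h⟩
  simp only [List.getElem?_map, Option.map_eq_some_iff] at hi
  obtain ⟨v, hv, rfl⟩ := hi
  obtain ⟨hv1, rfl⟩ : i < 25 ∧ i = v := by
    rw [List.getElem?_eq_some_iff] at hv
    obtain ⟨h1, h2⟩ := hv
    simp at h1 h2
    exact ⟨h1, h2⟩
  have := addE_z_rel (e := i) (by omega) unit_rel (by omega)
  exact ⟨Sem3.mono _ _ _ (by omega) this.1, this.2⟩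

theorem t0_ok : TstOk t0 := by
  intro e x hx h
  have : e < x := Nat.le_of_ble_eq_true h
  omega
theorem t1_ok : TstOk t1 := fun _ _ _ h => Nat.le_of_ble_eq_true h

def Φ5 (K : ℕ) : ℕ → Finset (List ℕ) :=
  nxt t1 K (nxt t1 K (nxt t1 K (nxt t1 K (nxt t0 K Φ0))))

theorem run_imp {K tot : ℕ} (h : run K vs tot = true) :
    ∃ G, GRel 10 11 G (Φ5 K) ∧ fin K G vs = tot := by
  have h : r0 K vs tot (G0 vs) = true := h
  have g0 := G0_rel
  obtain ⟨c, h⟩ := and'_true h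
  have g1 := mkG_rel t0_ok (K := K) (GRel_chk g0 c)
  obtain ⟨c, h⟩ := and'_true h
  have g2 := mkG_rel t1_ok (K := K) (GRel_chk g1 c)
  obtain ⟨c, h⟩ := and'_true h
  have g3 := mkG_rel t1_ok (K := K) (GRel_chk g2 c)
  obtain ⟨c, h⟩ := and'_true h
  have g4 := mkG_rel t1_ok (K := K) (GRel_chk g3 c)
  obtain ⟨c, h⟩ := and'_true h
  have g5 := mkG_rel t1_ok (K := K) (GRel_chk g4 c)
  obtain ⟨c, h⟩ := and'_true h
  exact ⟨_, GRel_chk g5 c, Nat.eq_of_beq_eq_true h⟩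

theorem fin_eq (K : ℕ) (G : List T3) (l : List ℕ) :
    fin K G l = (l.map (fun v => fin1 v (sumU t1 11 (K - v) G 0))).sum := by
  induction l with
  | nil => rfl
  | cons v l ih => rw [List.map_cons, List.sum_cons, ← ih, Nat.add_comm]; rfl
end EM

namespace EM
/-! ### Scalar products of digit vectors -/
theorem digB (B : ℕ) (hB : 0 < B) (n : ℕ) (f : ℕ → ℕ) (hf : ∀ i, f i < B) (j : ℕ) (hj : j < n) :
    (∑ i ∈ Finset.range n, f i * B ^ i) / B ^ j % B = f j := by
  induction j generalizing n f with
  | zero =>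
    obtain ⟨m, rfl⟩ : ∃ m, n = m + 1 := ⟨n - 1, by omega⟩
    rw [Finset.sum_range_succ']
    have : ∑ k ∈ Finset.range m, f (k + 1) * B ^ (k + 1) =
        B * ∑ k ∈ Finset.range m, f (k + 1) * B ^ k := by
      rw [Finset.mul_sum]; apply Finset.sum_congr rfl; intro k _; ring
    rw [this]
    simp [Nat.mod_eq_of_lt (hf 0)]
  | succ j ih =>
    obtain ⟨m, rfl⟩ : ∃ m, n = m + 1 := ⟨n - 1, by omega⟩
    rw [Finset.sum_range_succ']
    have : ∑ k ∈ Finset.range m, f (k + 1) * B ^ (k + 1) =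
        B * ∑ k ∈ Finset.range m, f (k + 1) * B ^ k := by
      rw [Finset.mul_sum]; apply Finset.sum_congr rfl; intro k _; ring
    rw [this, pow_succ', ← Nat.div_div_eq_div_mul, pow_zero, Nat.mul_one, Nat.mul_add_div hB,
      Nat.div_eq_of_lt (hf 0), Nat.add_zero]
    exact ih m (fun i => f (i + 1)) (fun i => hf _) (by omega)

theorem sum_dig (n N : ℕ) : ∑ i ∈ Finset.range n, dig N i * 256 ^ i = N % 256 ^ n := by
  induction n with
  | zero => simp [Nat.mod_one]
  | succ n ih => rw [Finset.sum_range_succ, ih, mod_succ, Nat.mul_comm]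

theorem lt_of_dig (n N : ℕ) (h : ∀ i, n ≤ i → dig N i = 0) : N < 256 ^ n := by
  have h1 : ∀ m, N % 256 ^ (n + m) = N % 256 ^ n := by
    intro m
    induction m with
    | zero => rfl
    | succ m ih => rw [← Nat.add_assoc, mod_succ, h _ (by omega), ih, Nat.mul_zero, Nat.add_zero]
  have h2 : N < 256 ^ (n + N) :=
    lt_of_lt_of_le (Nat.lt_pow_self (by norm_num)) (Nat.pow_le_pow_right (by norm_num) (by omega : N ≤ n + N))
  rw [← Nat.mod_eq_of_lt h2, h1]
  exact Nat.mod_lt _ (by positivity)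

theorem eq_sum_dig (n N : ℕ) (h : ∀ i, n ≤ i → dig N i = 0) :
    N = ∑ i ∈ Finset.range n, dig N i * 256 ^ i := by
  rw [sum_dig, Nat.mod_eq_of_lt (lt_of_dig n N h)]

theorem dig_of_lt (n N : ℕ) (h : N < 256 ^ n) (i : ℕ) (hi : n ≤ i) : dig N i = 0 := by
  unfold dig
  rw [Nat.div_eq_of_lt (lt_of_lt_of_le h (Nat.pow_le_pow_right (by norm_num) hi))]

theorem R_sum (r : ℕ) (hr : r < 3) (m : ℕ) :
    ∑ i ∈ Finset.range (3 * m), (if i % 3 = r then 255 else 0) * 256 ^ i =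
      255 * 256 ^ r * ∑ j ∈ Finset.range m, 16777216 ^ j := by
  induction m with
  | zero => simp
  | succ m ih =>
    rw [show 3 * (m + 1) = 3 * m + 1 + 1 + 1 by ring, Finset.sum_range_succ, Finset.sum_range_succ,
      Finset.sum_range_succ, ih, Finset.sum_range_succ]
    have e : (16777216 : ℕ) ^ m = 256 ^ (3 * m) := by
      rw [pow_mul, show (256 : ℕ) ^ 3 = 16777216 by norm_num]
    rw [e]
    have h0 : 3 * m % 3 = 0 := by omega
    have h1 : (3 * m + 1) % 3 = 1 := by omega
    have h2 : (3 * m + 1 + 1) % 3 = 2 := by omega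
    rw [h0, h1, h2]
    interval_cases r <;> simp <;> ring

theorem R_dig (r : ℕ) (hr : r < 3) (i : ℕ) (hi : i < 2048) :
    dig (255 * 256 ^ r * ((256 ^ 2049 - 1) / 16777215)) i = if i % 3 = r then 255 else 0 := by
  have h1 := Nat.geomSum_eq (m := 16777216) (by norm_num) 683
  have h2 : (16777216 : ℕ) ^ 683 = 256 ^ 2049 := by
    rw [show (16777216 : ℕ) = 256 ^ 3 by norm_num, ← pow_mul]
  rw [h2] at h1
  have h3 : (16777216 : ℕ) - 1 = 16777215 := rfl
  rw [h3] at h1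
  rw [← h1, ← R_sum r hr 683]
  exact digB 256 (by norm_num) 2049 (fun i => if i % 3 = r then 255 else 0)
    (fun i => by split_ifs <;> omega) i (by omega)

theorem land_R (r : ℕ) (hr : r < 3) (a R : ℕ) (ha : a < 256 ^ 2048)
    (hR : R = 255 * 256 ^ r * ((256 ^ 2049 - 1) / 16777215)) :
    Nat.land a R = ∑ i ∈ Finset.range 2048, (if i % 3 = r then dig a i else 0) * 256 ^ i := by
  have hz := dig_of_lt 2048 a ha
  rw [eq_sum_dig 2048 (Nat.land a R)]
  · apply Finset.sum_congr rfl
    intro i hi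
    rw [dig_land, hR, R_dig r hr i (Finset.mem_range.1 hi)]
    congr 1
    split_ifs
    · exact land_255 _ (dig_le _ _)
    · simp
  · intro i hi
    rw [dig_land, hz i hi, Nat.zero_and]

def D (n a b : ℕ) : ℕ := ∑ i ∈ Finset.range n, dig a i * dig b (n - 1 - i)

theorem sum_pick (n m : ℕ) (f : ℕ → ℕ) :
    ∑ j ∈ Finset.range n, (if j = m then f j else 0) = if m < n then f m else 0 := by
  rw [Finset.sum_ite_eq' ]; simp

theorem dl2_alg (n : ℕ) (a b : ℕ → ℕ) (X : ℕ) :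
    (∑ i ∈ Finset.range n, (if i % 3 = 0 then a i else 0) * X ^ i) *
      (∑ i ∈ Finset.range n, (if i % 3 = 1 then b i else 0) * X ^ i) +
    ((∑ i ∈ Finset.range n, (if i % 3 = 1 then a i else 0) * X ^ i) *
      (∑ i ∈ Finset.range n, (if i % 3 = 0 then b i else 0) * X ^ i) +
     (∑ i ∈ Finset.range n, (if i % 3 = 2 then a i else 0) * X ^ i) *
      (∑ i ∈ Finset.range n, (if i % 3 = 2 then b i else 0) * X ^ i)) =
    X * ∑ k ∈ Finset.range n, (∑ i ∈ Finset.range n, ∑ j ∈ Finset.range n,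
      if i + j = 3 * k + 1 then a i * b j else 0) * (X ^ 3) ^ k := by
  have h1 : ∀ i ∈ Finset.range n, ∀ j ∈ Finset.range n,
      (∑ k ∈ Finset.range n, (if i + j = 3 * k + 1 then a i * b j else 0) * (X ^ 3) ^ k) * X =
      if (i + j) % 3 = 1 then a i * b j * X ^ (i + j) else 0 := by
    intro i hi j hj
    rw [Finset.mem_range] at hi hj
    split_ifs with h
    · rw [Finset.sum_eq_single ((i + j) / 3)]
      · rw [if_pos (by omega), Nat.mul_assoc, ← pow_mul, ← pow_succ]
        congr 2; omega
      · intro k _ hk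
        rw [if_neg (by omega), Nat.zero_mul]
      · intro hk
        rw [Finset.mem_range] at hk; omega
    · rw [Finset.sum_eq_zero, Nat.zero_mul]
      intro k _
      rw [if_neg (by omega), Nat.zero_mul]
  have h2 : X * ∑ k ∈ Finset.range n, (∑ i ∈ Finset.range n, ∑ j ∈ Finset.range n,
      if i + j = 3 * k + 1 then a i * b j else 0) * (X ^ 3) ^ k =
      ∑ i ∈ Finset.range n, ∑ j ∈ Finset.range n,
        if (i + j) % 3 = 1 then a i * b j * X ^ (i + j) else 0 := by
    rw [Nat.mul_comm]
    simp only [Finset.sum_mul]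
    rw [Finset.sum_comm]
    apply Finset.sum_congr rfl
    intro i hi
    rw [Finset.sum_comm]
    apply Finset.sum_congr rfl
    intro j hj
    rw [← h1 i hi j hj, Finset.sum_mul]
  rw [h2, Finset.sum_mul_sum, Finset.sum_mul_sum, Finset.sum_mul_sum, ← Finset.sum_add_distrib,
    ← Finset.sum_add_distrib]
  apply Finset.sum_congr rfl
  intro i _
  rw [← Finset.sum_add_distrib, ← Finset.sum_add_distrib]
  apply Finset.sum_congr rfl
  intro j _
  have hi : i % 3 = 0 ∨ i % 3 = 1 ∨ i % 3 = 2 := by omega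
  have hj : j % 3 = 0 ∨ j % 3 = 1 ∨ j % 3 = 2 := by omega
  rcases hi with hi | hi | hi <;> rcases hj with hj | hj | hj <;>
    simp [Nat.add_mod, hi, hj, pow_add] <;> ring

theorem R_eq (c r n m : ℕ) (h : c = 255 * 256 ^ r) :
    Nat.mul c (Nat.div (Nat.sub (Nat.pow 256 n) 1) m) = 255 * 256 ^ r * ((256 ^ n - 1) / m) := by
  rw [← h]; rfl
set_option exponentiation.threshold 3000 in
theorem R0_eq : R0 = 255 * 256 ^ 0 * ((256 ^ 2049 - 1) / 16777215) := by
  decide +kernel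
set_option exponentiation.threshold 3000 in
theorem R1_eq : R1 = 255 * 256 ^ 1 * ((256 ^ 2049 - 1) / 16777215) := by
  decide +kernel
set_option exponentiation.threshold 3000 in
theorem R2_eq : R2 = 255 * 256 ^ 2 * ((256 ^ 2049 - 1) / 16777215) := by
  decide +kernel

theorem dl2_eq (a b : ℕ) (ha : a < 256 ^ 2048) (hb : b < 256 ^ 2048) (ha' : ∀ i, dig a i ≤ 63)
    (hb' : ∀ i, dig b i ≤ 63) : dl2 a b = D 2048 a b := by
  have e0 : ∀ x, x < 256 ^ 2048 → Nat.land x R0 = _ := fun x hx => land_R 0 (by omega) x R0 hx R0_eq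
  have e1 : ∀ x, x < 256 ^ 2048 → Nat.land x R1 = _ := fun x hx => land_R 1 (by omega) x R1 hx R1_eq
  have e2 : ∀ x, x < 256 ^ 2048 → Nat.land x R2 = _ := fun x hx => land_R 2 (by omega) x R2 hx R2_eq
  have h1 : dl2 a b = (Nat.land a R0 * Nat.land b R1 + (Nat.land a R1 * Nat.land b R0 +
    Nat.land a R2 * Nat.land b R2)) >>> 16376 % 16777216 := rfl
  rw [h1, e0 a ha, e0 b hb, e1 a ha, e1 b hb, e2 a ha, e2 b hb,
    dl2_alg 2048 (dig a) (dig b) 256, Nat.shiftRight_eq_div_pow]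
  have h2 : (2 : ℕ) ^ 16376 = 256 * 16777216 ^ 682 := by
    rw [show (256 : ℕ) = 2 ^ 8 by norm_num, show (16777216 : ℕ) = 2 ^ 24 by norm_num, ← pow_mul,
      ← pow_add]
  have h3 : (256 : ℕ) ^ 3 = 16777216 := by norm_num
  rw [h2, h3, ← Nat.div_div_eq_div_mul, Nat.mul_div_cancel_left _ (by norm_num)]
  have inner : ∀ k, ∀ i ∈ Finset.range 2048, (∑ j ∈ Finset.range 2048,
      if i + j = 3 * k + 1 then dig a i * dig b j else 0) =
      if i ≤ 3 * k + 1 ∧ 3 * k + 1 - i < 2048 then dig a i * dig b (3 * k + 1 - i) else 0 := by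
    intro k i hi
    by_cases hik : i ≤ 3 * k + 1
    · have := sum_pick 2048 (3 * k + 1 - i) (fun j => dig a i * dig b j)
      simp only [hik, true_and]
      rw [← this]
      apply Finset.sum_congr rfl
      intro j _
      have : i + j = 3 * k + 1 ↔ j = 3 * k + 1 - i := by omega
      simp only [this]
    · rw [if_neg (by omega)]
      apply Finset.sum_eq_zero
      intro j _
      rw [if_neg (by omega)]
  rw [digB 16777216 (by norm_num) 2048 (fun k => ∑ i ∈ Finset.range 2048, ∑ j ∈ Finset.range 2048,
      if i + j = 3 * k + 1 then dig a i * dig b j else 0) _ 682 (by norm_num)]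
  · unfold D
    apply Finset.sum_congr rfl
    intro i hi
    rw [inner 682 i hi]
    rw [Finset.mem_range] at hi
    rw [if_pos (by omega)]
  · intro k
    calc _ = _ := Finset.sum_congr rfl (inner k)
      _ ≤ ∑ i ∈ Finset.range 2048, 63 * 63 := by
        apply Finset.sum_le_sum
        intro i _
        split_ifs
        · exact Nat.mul_le_mul (ha' _) (hb' _)
        · omega
      _ < 16777216 := by simp

theorem D_zero_left (n b : ℕ) : D n 0 b = 0 := by simp [D, dig_zero]
theorem D_zero_right (n a : ℕ) : D n a 0 = 0 := by simp [D, dig_zero]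

theorem dlz_eq (s a b : ℕ) (ha : a < 256 ^ 2048) (hb : b < 256 ^ 2048) (ha' : ∀ i, dig a i ≤ 63)
    (hb' : ∀ i, dig b i ≤ 63) : dlz s a b = s + D 2048 a b := by
  unfold dlz
  cases h1 : Nat.beq a 0 with
  | true =>
    have := Nat.eq_of_beq_eq_true h1
    subst this
    rw [D_zero_left]; rfl
  | false =>
    cases h2 : Nat.beq b 0 with
    | true =>
      have := Nat.eq_of_beq_eq_true h2
      subst this
      rw [D_zero_right]; rfl
    | false =>
      show dl2 a b + s = _
      rw [dl2_eq a b ha hb ha' hb', Nat.add_comm]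

theorem dig_mod (n N i : ℕ) : dig (N % 256 ^ n) i = if i < n then dig N i else 0 := by
  split_ifs with h
  · unfold dig
    rw [show n = i + (n - i) by omega, pow_add, Nat.mod_mul_right_div_self,
      Nat.mod_mod_of_dvd]
    exact dvd_pow_self _ (by omega)
  · exact dig_of_lt n _ (Nat.mod_lt _ (by positivity)) i (by omega)

theorem dig_div (n N i : ℕ) : dig (N / 256 ^ n) i = dig N (n + i) := by
  unfold dig
  rw [Nat.div_div_eq_div_mul, ← pow_add]

theorem D_split (n a b : ℕ) :
    D (2 * n) a b = D n (a % 256 ^ n) (b / 256 ^ n) + D n (a / 256 ^ n) (b % 256 ^ n) := by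
  unfold D
  rw [Nat.two_mul, Finset.sum_range_add]
  congr 1
  · apply Finset.sum_congr rfl
    intro i hi
    rw [Finset.mem_range] at hi
    rw [dig_mod, if_pos hi, dig_div]
    congr 2; omega
  · apply Finset.sum_congr rfl
    intro i hi
    rw [Finset.mem_range] at hi
    rw [dig_mod, if_pos (by omega), dig_div]
    congr 2; omega

theorem dlr_eq (d s a b : ℕ) (ha : a < 256 ^ (2048 * 2 ^ d)) (hb : b < 256 ^ (2048 * 2 ^ d))
    (ha' : ∀ i, dig a i ≤ 63) (hb' : ∀ i, dig b i ≤ 63) :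
    dlr d s a b = s + D (2048 * 2 ^ d) a b := by
  induction d generalizing s a b with
  | zero => exact dlz_eq s a b (by simpa using ha) (by simpa using hb) ha' hb'
  | succ d ih =>
    have hp : (2 : ℕ) ^ (16384 * 2 ^ d) = 256 ^ (2048 * 2 ^ d) := by
      rw [show (256 : ℕ) = 2 ^ 8 by norm_num, ← pow_mul]; congr 1; ring
    have e : dlr (d + 1) s a b = dlr d (dlr d s (a % 2 ^ (16384 * 2 ^ d)) (b >>> (16384 * 2 ^ d)))
        (a >>> (16384 * 2 ^ d)) (b % 2 ^ (16384 * 2 ^ d)) := by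
      rw [← Nat.and_two_pow_sub_one_eq_mod a, ← Nat.and_two_pow_sub_one_eq_mod b]
      rfl
    have hn : 2048 * 2 ^ (d + 1) = 2 * (2048 * 2 ^ d) := by ring
    rw [hn, Nat.two_mul, pow_add] at ha hb
    have hm : ∀ x, (∀ i, dig x i ≤ 63) → ∀ i, dig (x % 256 ^ (2048 * 2 ^ d)) i ≤ 63 := by
      intro x hx i
      rw [dig_mod]; split_ifs
      · exact hx i
      · omega
    have hq : ∀ x, (∀ i, dig x i ≤ 63) → ∀ i, dig (x / 256 ^ (2048 * 2 ^ d)) i ≤ 63 := by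
      intro x hx i
      rw [dig_div]; exact hx _
    have hml : ∀ x, x % 256 ^ (2048 * 2 ^ d) < 256 ^ (2048 * 2 ^ d) :=
      fun x => Nat.mod_lt _ (by positivity)
    rw [e, Nat.shiftRight_eq_div_pow, Nat.shiftRight_eq_div_pow, hp,
      ih s _ _ (hml a) (Nat.div_lt_of_lt_mul hb) (hm a ha') (hq b hb'),
      ih _ _ _ (Nat.div_lt_of_lt_mul ha) (hml b) (hq a ha') (hm b hb'), hn, D_split]
    ring

set_option maxRecDepth 10000 in
theorem land192 : ∀ x < 256, x &&& 192 = 0 → x < 64 := by decide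

theorem dl_eq (s a b : ℕ) (ha : Z 15 a) (hb : Z 15 b) : dl s a b = s + D (2 ^ 15) a b := by
  unfold dl
  cases h : Nat.beq (Nat.land (Nat.lor a b) c192) 0 with
  | false =>
    show s + dlspec a b = _
    unfold dlspec D
    rw [show (2 : ℕ) ^ 15 = 32768 by norm_num]
    rfl
  | true =>
    have h := Nat.eq_of_beq_eq_true h
    have hx : ∀ i, dig a i ≤ 63 ∧ dig b i ≤ 63 := by
      intro i
      by_cases hi : i < 2 ^ 15
      · have h1 : dig (Nat.land (Nat.lor a b) c192) i = 0 := by rw [h, dig_zero]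
        have h2 : dig c192 i = 192 := (cst_spec 192 (by norm_num)).2 i hi
        rw [dig_land, h2] at h1
        have h3 := dig_le (Nat.lor a b) i
        have h4 := land192 _ (by omega) h1
        rw [dig_lor] at h4
        have h5 : dig a i ≤ dig a i ||| dig b i := Nat.left_le_or
        have h6 : dig b i ≤ dig a i ||| dig b i := Nat.right_le_or
        omega
      · rw [ha i (by omega), hb i (by omega)]; omega
    have e15 : 2048 * 2 ^ 4 = 2 ^ 15 := by norm_num
    rw [← e15]
    refine dlr_eq 4 s a b ?_ ?_ (fun i => (hx i).1) (fun i => (hx i).2)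
    · rw [e15]; exact lt_of_dig (2 ^ 15) a ha
    · rw [e15]; exact lt_of_dig (2 ^ 15) b hb
end EM

namespace EM
/-! ### Scalar products of trees -/
variable {α : Type}

def W : ℕ → (Finset ℕ → ℕ) → (Finset ℕ → ℕ) → ℕ
  | 0, f, g => f ∅ * g ∅
  | k + 1, f, g => W k f (fun S => g (insert (k + 1) S)) + W k (fun S => f (insert (k + 1) S)) g

theorem W_congr (k : ℕ) (f f' g g' : Finset ℕ → ℕ) (hf : ∀ S, S ⊆ Finset.Icc 1 k → f S = f' S)
    (hg : ∀ S, S ⊆ Finset.Icc 1 k → g S = g' S) : W k f g = W k f' g' := by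
  induction k generalizing f f' g g' with
  | zero => rw [W, W, hf ∅ (by simp), hg ∅ (by simp)]
  | succ k ih =>
    have h1 : Finset.Icc 1 k ⊆ Finset.Icc 1 (k + 1) := Finset.Icc_subset_Icc_right (by omega)
    have h2 : ∀ S, S ⊆ Finset.Icc 1 k → insert (k + 1) S ⊆ Finset.Icc 1 (k + 1) := by
      intro S hS
      exact Finset.insert_subset (by simp) (hS.trans h1)
    rw [W, W, ih f f' (fun S => g (insert (k + 1) S)) (fun S => g' (insert (k + 1) S))
        (fun S hS => hf S (hS.trans h1)) (fun S hS => hg _ (h2 S hS)),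
      ih (fun S => f (insert (k + 1) S)) (fun S => f' (insert (k + 1) S)) g g'
        (fun S hS => hf _ (h2 S hS)) (fun S hS => hg S (hS.trans h1))]

theorem W_zero_left (k : ℕ) (g : Finset ℕ → ℕ) : W k (fun _ => 0) g = 0 := by
  induction k generalizing g with
  | zero => simp [W]
  | succ k ih => rw [W, ih, ih]
theorem W_zero_right (k : ℕ) (f : Finset ℕ → ℕ) : W k f (fun _ => 0) = 0 := by
  induction k generalizing f with
  | zero => simp [W]
  | succ k ih => rw [W, ih, ih]

theorem W_sum (k : ℕ) (f g : Finset ℕ → ℕ) :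
    W k f g = ∑ T ∈ (Finset.Icc 1 k).powerset, f T * g (Finset.Icc 1 k \ T) := by
  induction k generalizing f g with
  | zero => simp [W]
  | succ k ih =>
    have h1 : Finset.Icc 1 (k + 1) = insert (k + 1) (Finset.Icc 1 k) := by
      ext x; simp; omega
    rw [W, ih, ih, h1, Finset.sum_powerset_insert (by simp)]
    congr 1
    · apply Finset.sum_congr rfl
      intro T hT
      rw [Finset.mem_powerset] at hT
      rw [Finset.insert_sdiff_of_notMem]
      intro h; have := hT h; simp at this
    · apply Finset.sum_congr rfl
      intro T hT
      rw [Finset.insert_sdiff_insert, Finset.sdiff_insert_of_notMem (by simp)]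

theorem W_idx (k : ℕ) (F G : ℕ → ℕ) : ∑ i ∈ Finset.range (2 ^ k), F i * G (2 ^ k - 1 - i) =
    W k (fun S => F (idx k S)) (fun S => G (idx k S)) := by
  induction k generalizing F G with
  | zero => simp [W, idx]
  | succ k ih =>
    rw [pow_succ, Nat.mul_two, Finset.sum_range_add, W]
    have h1 : ∀ S, S ⊆ Finset.Icc 1 k → idx (k + 1) S = idx k S := by
      intro S hS
      rw [idx, if_neg, Nat.add_zero]
      intro h; have := hS h; simp at this
    have h2 : ∀ S, S ⊆ Finset.Icc 1 k → idx (k + 1) (insert (k + 1) S) = 2 ^ k + idx k S := by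
      intro S hS
      rw [idx, if_pos (by simp), Nat.add_comm, idx_congr k (insert (k + 1) S) S]
      intro e he
      rw [Finset.mem_insert]
      constructor
      · rintro (h | h)
        · omega
        · exact h
      · exact fun h => Or.inr h
    rw [W_congr k _ (fun S => F (idx k S)) _ (fun S => G (2 ^ k + idx k S))
      (fun S hS => by rw [h1 S hS]) (fun S hS => by rw [h2 S hS]),
      W_congr k (fun S => F (idx (k + 1) (insert (k + 1) S))) (fun S => F (2 ^ k + idx k S)) _
        (fun S => G (idx k S)) (fun S hS => by rw [h2 S hS]) (fun S hS => by rw [h1 S hS]),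
      ← ih F (fun i => G (2 ^ k + i)), ← ih (fun i => F (2 ^ k + i)) G]
    congr 1
    · apply Finset.sum_congr rfl
      intro i hi
      rw [Finset.mem_range] at hi
      congr 2; omega
    · apply Finset.sum_congr rfl
      intro i hi
      rw [Finset.mem_range] at hi
      congr 2; omega

def DotOk (s : Sem α) (f : ℕ → α → α → ℕ) : Prop :=
  ∀ c b t u, s.bd b t → s.bd b u → f c t u = c + W s.top (s.sm t) (s.sm u)

theorem dot0_ok : DotOk Sem0 dot0 := by
  intro c b t u ht hu
  cases t with
  | z => exact (congrArg (c + ·) (W_zero_left 15 _)).symm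
  | lf N =>
    cases u with
    | z => exact (congrArg (c + ·) (W_zero_right 15 _)).symm
    | lf M =>
      show dl c N M = c + W 15 (fun S => dig N (idx 15 S)) (fun S => dig M (idx 15 S))
      rw [dl_eq c N M ht.2 hu.2, ← W_idx, D]

theorem loc_insert (s : Sem α) (t : α) (S : Finset ℕ) (e : ℕ) (h : s.top < e) :
    s.sm t (insert e S) = s.sm t S := by
  rw [← s.loc t (insert e S) e h, Finset.erase_insert_eq_erase, s.loc t S e h]

theorem sm8_simp (s : Sem α) (a0 a1 a2 a3 a4 a5 a6 a7 : α) (S : Finset ℕ)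
    (hS : S ⊆ Finset.Icc 1 s.top) :
    sm8 s (.n a0 a1 a2 a3 a4 a5 a6 a7) S = s.sm a0 S ∧
    sm8 s (.n a0 a1 a2 a3 a4 a5 a6 a7) (insert (s.top + 1) S) = s.sm a1 S ∧
    sm8 s (.n a0 a1 a2 a3 a4 a5 a6 a7) (insert (s.top + 2) S) = s.sm a2 S ∧
    sm8 s (.n a0 a1 a2 a3 a4 a5 a6 a7) (insert (s.top + 2) (insert (s.top + 1) S)) = s.sm a3 S ∧
    sm8 s (.n a0 a1 a2 a3 a4 a5 a6 a7) (insert (s.top + 3) S) = s.sm a4 S ∧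
    sm8 s (.n a0 a1 a2 a3 a4 a5 a6 a7) (insert (s.top + 3) (insert (s.top + 1) S)) = s.sm a5 S ∧
    sm8 s (.n a0 a1 a2 a3 a4 a5 a6 a7) (insert (s.top + 3) (insert (s.top + 2) S)) = s.sm a6 S ∧
    sm8 s (.n a0 a1 a2 a3 a4 a5 a6 a7)
      (insert (s.top + 3) (insert (s.top + 2) (insert (s.top + 1) S))) = s.sm a7 S := by
  have n1 : s.top + 1 ∉ S := fun h => by have := hS h; simp at this
  have n2 : s.top + 2 ∉ S := fun h => by have := hS h; simp at this
  have n3 : s.top + 3 ∉ S := fun h => by have := hS h; simp at this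
  have l1 := fun t S => loc_insert s t S (s.top + 1) (by omega)
  have l2 := fun t S => loc_insert s t S (s.top + 2) (by omega)
  have l3 := fun t S => loc_insert s t S (s.top + 3) (by omega)
  simp [sm8, sel, n1, n2, n3, l1, l2, l3]

theorem dotN_ok (s : Sem α) (f : ℕ → α → α → ℕ) (hf : DotOk s f) : DotOk (Sem8 s) (dotN α f) := by
  intro c b t u ht hu
  cases t with
  | z => exact (congrArg (c + ·) (W_zero_left _ _)).symm
  | n a0 a1 a2 a3 a4 a5 a6 a7 =>
    cases u with
    | z => exact (congrArg (c + ·) (W_zero_right _ _)).symm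
    | n b0 b1 b2 b3 b4 b5 b6 b7 =>
      obtain ⟨t0, t1, t2, t3, t4, t5, t6, t7⟩ := ht
      obtain ⟨u0, u1, u2, u3, u4, u5, u6, u7⟩ := hu
      have ha := fun S hS => sm8_simp s a0 a1 a2 a3 a4 a5 a6 a7 S hS
      have hb := fun S hS => sm8_simp s b0 b1 b2 b3 b4 b5 b6 b7 S hS
      show f (f (f (f (f (f (f (f c a0 b7) a1 b6) a2 b5) a3 b4) a4 b3) a5 b2) a6 b1) a7 b0 =
        c + W (s.top + 3) (sm8 s (.n a0 a1 a2 a3 a4 a5 a6 a7)) (sm8 s (.n b0 b1 b2 b3 b4 b5 b6 b7))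
      rw [hf _ b _ _ t7 u0, hf _ b _ _ t6 u1, hf _ b _ _ t5 u2, hf _ b _ _ t4 u3, hf _ b _ _ t3 u4,
        hf _ b _ _ t2 u5, hf _ b _ _ t1 u6, hf _ b _ _ t0 u7]
      simp only [W]
      rw [W_congr s.top (fun S => sm8 s (.n a0 a1 a2 a3 a4 a5 a6 a7) S) (s.sm a0) _ (s.sm b7)
        (fun S hS => (ha S hS).1) (fun S hS => (hb S hS).2.2.2.2.2.2.2),
        W_congr s.top _ (s.sm a1) _ (s.sm b6)
        (fun S hS => (ha S hS).2.1) (fun S hS => (hb S hS).2.2.2.2.2.2.1),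
        W_congr s.top _ (s.sm a2) _ (s.sm b5)
        (fun S hS => (ha S hS).2.2.1) (fun S hS => (hb S hS).2.2.2.2.2.1),
        W_congr s.top _ (s.sm a3) _ (s.sm b4)
        (fun S hS => (ha S hS).2.2.2.1) (fun S hS => (hb S hS).2.2.2.2.1),
        W_congr s.top _ (s.sm a4) _ (s.sm b3)
        (fun S hS => (ha S hS).2.2.2.2.1) (fun S hS => (hb S hS).2.2.2.1),
        W_congr s.top _ (s.sm a5) _ (s.sm b2)
        (fun S hS => (ha S hS).2.2.2.2.2.1) (fun S hS => (hb S hS).2.2.1),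
        W_congr s.top _ (s.sm a6) _ (s.sm b1)
        (fun S hS => (ha S hS).2.2.2.2.2.2.1) (fun S hS => (hb S hS).2.1),
        W_congr s.top _ (s.sm a7) _ (s.sm b0)
        (fun S hS => (ha S hS).2.2.2.2.2.2.2) (fun S hS => (hb S hS).1)]
      ring

theorem dotH_ok (s : Sem α) (f : ℕ → α → α → ℕ) (hf : DotOk s f) (c b : ℕ) (t u : N8 α)
    (ht : (Sem8 s).bd b t) (hu : (Sem8 s).bd b u) :
    dotH α f c t u = c + W (s.top + 2) (fun S => sm8 s t (insert (s.top + 3) S)) (sm8 s u) := by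
  cases t with
  | z => exact (congrArg (c + ·) (W_zero_left _ _)).symm
  | n a0 a1 a2 a3 a4 a5 a6 a7 =>
    cases u with
    | z => exact (congrArg (c + ·) (W_zero_right _ _)).symm
    | n b0 b1 b2 b3 b4 b5 b6 b7 =>
      obtain ⟨t0, t1, t2, t3, t4, t5, t6, t7⟩ := ht
      obtain ⟨u0, u1, u2, u3, u4, u5, u6, u7⟩ := hu
      have ha := fun S hS => sm8_simp s a0 a1 a2 a3 a4 a5 a6 a7 S hS
      have hb := fun S hS => sm8_simp s b0 b1 b2 b3 b4 b5 b6 b7 S hS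
      show f (f (f (f c a4 b3) a5 b2) a6 b1) a7 b0 = _
      rw [hf _ b _ _ t7 u0, hf _ b _ _ t6 u1, hf _ b _ _ t5 u2, hf _ b _ _ t4 u3]
      simp only [W]
      rw [W_congr s.top _ (s.sm a4) _ (s.sm b3)
        (fun S hS => (ha S hS).2.2.2.2.1) (fun S hS => (hb S hS).2.2.2.1),
        W_congr s.top _ (s.sm a5) _ (s.sm b2)
        (fun S hS => (ha S hS).2.2.2.2.2.1) (fun S hS => (hb S hS).2.2.1),
        W_congr s.top _ (s.sm a6) _ (s.sm b1)
        (fun S hS => (ha S hS).2.2.2.2.2.2.1) (fun S hS => (hb S hS).2.1),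
        W_congr s.top _ (s.sm a7) _ (s.sm b0)
        (fun S hS => (ha S hS).2.2.2.2.2.2.2) (fun S hS => (hb S hS).1)]
      ring

theorem hdot_eq (c b : ℕ) (t u : T3) (ht : Sem3.bd b t) (hu : Sem3.bd b u) :
    hdot c t u = c + ∑ T ∈ (Finset.Icc 1 23).powerset,
      Sem3.sm t (insert 24 T) * Sem3.sm u (Finset.Icc 1 23 \ T) := by
  rw [← W_sum 23 (fun T => Sem3.sm t (insert 24 T))]
  exact dotH_ok Sem2 _ (dotN_ok Sem1 _ (dotN_ok Sem0 _ dot0_ok)) c b t u ht hu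
end EM

namespace EM
/-! ### From scalar products to pairs of lists -/
theorem set_key (A B T : Finset ℕ) (hA : A ⊆ Finset.range 25) (hB : B ⊆ Finset.range 25)
    (cA : A.card = 13) (cB : B.card = 12) (hT : T ⊆ Finset.Icc 1 23) :
    (A.erase 0 = insert 24 T ∧ B.erase 0 = Finset.Icc 1 23 \ T) ↔
      (Disjoint A B ∧ 24 ∈ A ∧ (A.erase 0).erase 24 = T) := by
  have hT24 : 24 ∉ T := fun h => by have := hT h; simp at this
  constructor
  · rintro ⟨h1, h2⟩
    refine ⟨?_, ?_, ?_⟩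
    · rw [Finset.disjoint_left]
      intro x hx1 hx2
      by_cases hx : x = 0
      · subst hx
        have e1 := Finset.card_erase_of_mem hx1
        have e2 := Finset.card_erase_of_mem hx2
        rw [h1, Finset.card_insert_of_notMem hT24] at e1
        rw [h2, Finset.card_sdiff_of_subset hT, Nat.card_Icc] at e2
        omega
      · have e1 := Finset.mem_erase.2 ⟨hx, hx1⟩
        have e2 := Finset.mem_erase.2 ⟨hx, hx2⟩
        rw [h1, Finset.mem_insert] at e1
        rw [h2, Finset.mem_sdiff, Finset.mem_Icc] at e2
        rcases e1 with e1 | e1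
        · omega
        · exact e2.2 e1
    · have : 24 ∈ A.erase 0 := by rw [h1]; simp
      exact Finset.mem_of_mem_erase this
    · rw [h1, Finset.erase_insert hT24]
  · rintro ⟨h1, h2, h3⟩
    have hU : A ∪ B = Finset.range 25 := by
      apply Finset.eq_of_subset_of_card_le (Finset.union_subset hA hB)
      rw [Finset.card_union_of_disjoint h1, cA, cB]; simp
    have h4 : A.erase 0 = insert 24 T := by
      rw [← h3, Finset.insert_erase]
      exact Finset.mem_erase.2 ⟨by norm_num, h2⟩
    refine ⟨h4, ?_⟩
    ext x
    have e1 : x ∈ A ∪ B ↔ x ∈ Finset.range 25 := by rw [hU]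
    rw [Finset.mem_union, Finset.mem_range] at e1
    have e2 : x ∈ A → x ∉ B := fun a b => Finset.disjoint_left.1 h1 a b
    rw [Finset.mem_sdiff, ← h3]
    simp only [Finset.mem_erase, Finset.mem_Icc]
    constructor
    · rintro ⟨a, b⟩
      have : x ≠ 24 := by rintro rfl; exact e2 h2 b
      have := e1.1 (Or.inr b)
      exact ⟨by omega, fun h => e2 h.2.2 b⟩
    · rintro ⟨⟨a, b⟩, c⟩
      refine ⟨by omega, ?_⟩
      rcases e1.2 (by omega) with h | h
      · exact absurd ⟨by omega, by omega, h⟩ c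
      · exact h

def PP (v : ℕ) (F : Finset (List ℕ)) : Finset (List ℕ × List ℕ) :=
  (F ×ˢ F).filter (fun q => (v :: (q.1 ++ q.2)).Nodup)

theorem mem_PP {v : ℕ} {F : Finset (List ℕ)} {q : List ℕ × List ℕ} :
    q ∈ PP v F ↔ q.1 ∈ F ∧ q.2 ∈ F ∧ (v :: (q.1 ++ q.2)).Nodup := by
  rw [PP, Finset.mem_filter, Finset.mem_product, and_assoc]

theorem half_card {v : ℕ} (hv : v ≤ 24) {F : Finset (List ℕ)} (hF : WF 12 F) :
    ((PP v F).filter (fun q => 24 ∈ v :: q.1)).card =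
      ∑ T ∈ (Finset.Icc 1 23).powerset, tab (ext v F) (insert 24 T) *
        tab F (Finset.Icc 1 23 \ T) := by
  rw [Finset.card_eq_sum_card_fiberwise (t := (Finset.Icc 1 23).powerset)
    (f := fun q => ((v :: q.1).toFinset.erase 0).erase 24)]
  · apply Finset.sum_congr rfl
    intro T hT
    rw [Finset.mem_powerset] at hT
    unfold tab
    rw [← Finset.card_product]
    have key : ∀ l1 l2, l1 ∈ F → l2 ∈ F → v ∉ l1 →
      (((v :: l1).toFinset.erase 0 = insert 24 T ∧ l2.toFinset.erase 0 = Finset.Icc 1 23 \ T) ↔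
      (Disjoint (v :: l1).toFinset l2.toFinset ∧ 24 ∈ (v :: l1).toFinset ∧
        ((v :: l1).toFinset.erase 0).erase 24 = T)) := by
      intro l1 l2 h1 h2 h3
      obtain ⟨a1, a2, a3⟩ := hF l1 h1
      obtain ⟨b1, b2, b3⟩ := hF l2 h2
      apply set_key _ _ _ _ _ _ _ hT
      · intro x hx
        rw [List.mem_toFinset, List.mem_cons] at hx
        rw [Finset.mem_range]
        rcases hx with rfl | hx
        · omega
        · have := a3 x hx; omega
      · intro x hx
        rw [List.mem_toFinset] at hx
        rw [Finset.mem_range]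
        have := b3 x hx; omega
      · rw [List.toFinset_card_of_nodup (List.nodup_cons.2 ⟨h3, a1⟩), List.length_cons, a2]
      · rw [List.toFinset_card_of_nodup b1, b2]
    have nd : ∀ l1 l2, l1 ∈ F → l2 ∈ F → ((v :: (l1 ++ l2)).Nodup ↔
        v ∉ l1 ∧ Disjoint (v :: l1).toFinset l2.toFinset) := by
      intro l1 l2 h1 h2
      rw [← List.cons_append, List.nodup_append', List.nodup_cons, List.disjoint_toFinset_iff_disjoint]
      have := (hF l1 h1).1
      have := (hF l2 h2).1
      tauto
    apply Finset.card_bij (fun q _ => (v :: q.1, q.2))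
    · rintro ⟨l1, l2⟩ hq
      simp only [Finset.mem_filter, mem_PP] at hq
      obtain ⟨⟨⟨h1, h2, h3⟩, h4⟩, h5⟩ := hq
      rw [nd l1 l2 h1 h2] at h3
      have := (key l1 l2 h1 h2 h3.1).2 ⟨h3.2, List.mem_toFinset.2 h4, h5⟩
      simp only [Finset.mem_product, Finset.mem_filter, mem_ext]
      exact ⟨⟨⟨l1, h1, h3.1, rfl⟩, this.1⟩, h2, this.2⟩
    · rintro ⟨l1, l2⟩ _ ⟨m1, m2⟩ _ h
      simpa using h
    · rintro ⟨l, l2⟩ hq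
      simp only [Finset.mem_product, Finset.mem_filter, mem_ext] at hq
      obtain ⟨⟨⟨l1, h1, h3, rfl⟩, h4⟩, h2, h5⟩ := hq
      obtain ⟨k1, k2, k3⟩ := (key l1 l2 h1 h2 h3).1 ⟨h4, h5⟩
      refine ⟨(l1, l2), ?_, rfl⟩
      simp only [Finset.mem_filter, mem_PP]
      exact ⟨⟨⟨h1, h2, (nd l1 l2 h1 h2).2 ⟨h3, k1⟩⟩, List.mem_toFinset.1 k2⟩, k3⟩
  · rintro ⟨l1, l2⟩ hq
    simp only [Finset.coe_filter, mem_PP, Set.mem_ofPred_eq] at hq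
    obtain ⟨⟨h1, h2, h3⟩, h4⟩ := hq
    simp only [Finset.coe_powerset, Set.mem_preimage, Set.mem_powerset_iff, Finset.coe_subset]
    intro x hx
    simp only [Finset.mem_erase, List.mem_toFinset, List.mem_cons] at hx
    rw [Finset.mem_Icc]
    obtain ⟨x1, x2, x3⟩ := hx
    rcases x3 with rfl | x3
    · omega
    · have := (hF l1 h1).2.2 x x3; omega

theorem PP_card {v : ℕ} (hv : v ≤ 24) {F : Finset (List ℕ)} (hF : WF 12 F) :
    (PP v F).card = (if v = 24 then 1 else 2) *
      ((PP v F).filter (fun q => 24 ∈ v :: q.1)).card := by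
  split_ifs with h
  · rw [Nat.one_mul]
    congr 1
    symm
    rw [Finset.filter_eq_self]
    intro q _
    rw [h]; simp
  · have e1 := Finset.card_filter_add_card_filter_not (s := PP v F) (fun q => 24 ∈ v :: q.1)
    have e2 : ((PP v F).filter (fun q => ¬ 24 ∈ v :: q.1)).card =
        ((PP v F).filter (fun q => 24 ∈ v :: q.1)).card := by
      have perm : ∀ l1 l2 : List ℕ, (v :: (l1 ++ l2)).Nodup → (v :: (l2 ++ l1)).Nodup := by
        intro l1 l2 h
        exact ((List.perm_append_comm.cons v).nodup_iff).1 h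
      have h24 : ∀ l1 l2, l1 ∈ F → l2 ∈ F → (v :: (l1 ++ l2)).Nodup → 24 ∈ v :: (l1 ++ l2) := by
        intro l1 l2 h1 h2 h3
        obtain ⟨a1, a2, a3⟩ := hF l1 h1
        obtain ⟨b1, b2, b3⟩ := hF l2 h2
        have : (v :: (l1 ++ l2)).toFinset = Finset.range 25 := by
          apply Finset.eq_of_subset_of_card_le
          · intro x hx
            rw [List.mem_toFinset, List.mem_cons, List.mem_append] at hx
            rw [Finset.mem_range]
            rcases hx with rfl | hx | hx
            · omega
            · have := a3 x hx; omega
            · have := b3 x hx; omega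
          · rw [List.toFinset_card_of_nodup h3, List.length_cons, List.length_append, a2, b2]
            simp
        rw [← List.mem_toFinset, this]; simp
      apply Finset.card_bij (fun q _ => (q.2, q.1))
      · rintro ⟨l1, l2⟩ hq
        simp only [Finset.mem_filter, mem_PP] at hq ⊢
        obtain ⟨⟨h1, h2, h3⟩, h4⟩ := hq
        refine ⟨⟨h2, h1, perm _ _ h3⟩, ?_⟩
        have := h24 l1 l2 h1 h2 h3
        rw [List.mem_cons, List.mem_append] at this
        rw [List.mem_cons] at h4 ⊢
        tauto
      · rintro ⟨l1, l2⟩ _ ⟨m1, m2⟩ _ h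
        simp only [Prod.mk.injEq] at h ⊢
        exact ⟨h.2, h.1⟩
      · rintro ⟨l1, l2⟩ hq
        simp only [Finset.mem_filter, mem_PP] at hq
        obtain ⟨⟨h1, h2, h3⟩, h4⟩ := hq
        refine ⟨(l2, l1), ?_, rfl⟩
        simp only [Finset.mem_filter, mem_PP]
        refine ⟨⟨h2, h1, perm _ _ h3⟩, ?_⟩
        rw [List.mem_cons] at h4 ⊢
        intro h5
        rcases h5 with h5 | h5
        · exact h h5.symm
        · rcases h4 with h4 | h4
          · exact h h4.symm
          · rw [List.nodup_cons, List.nodup_append'] at h3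
            exact h3.2.2.2 h4 h5
    omega

theorem fin1_eq {v : ℕ} (hv : v ≤ 24) {U : T3} {F : Finset (List ℕ)} (h : Rel 250 12 U F) :
    fin1 v U = (PP v F).card := by
  have h2 := addE_z_rel hv h (by norm_num)
  have e : fin1 v U = (if v = 24 then 1 else 2) * hdot 0 (addE 12 v U .z) U := by
    unfold fin1
    cases hb : Nat.beq v 24 with
    | true => rw [if_pos (Nat.eq_of_beq_eq_true hb)]; rfl
    | false => rw [if_neg (Nat.ne_of_beq_eq_false hb)]; rfl
  rw [e, PP_card hv h.2.1, half_card hv h.2.1, hdot_eq 0 250 _ _ h2.1 h.1, Nat.zero_add]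
  refine congrArg _ (Finset.sum_congr rfl ?_)
  intro T hT
  rw [Finset.mem_powerset] at hT
  have hs : Finset.Icc 1 23 ⊆ Om := Finset.Icc_subset_Icc_right (by norm_num)
  rw [h2.2.2 _ (Finset.insert_subset (by simp [Om]) (hT.trans hs)),
    h.2.2 _ (Finset.sdiff_subset.trans hs)]

theorem run_card {K tot : ℕ} (h : run K vs tot = true) :
    ∑ v ∈ Finset.range 25, (PP v (Uf t1 (K - v) (Φ5 K))).card = tot := by
  obtain ⟨G, hG, hf⟩ := run_imp h
  have e : ∀ (n : ℕ) (f : ℕ → ℕ), ((List.range n).map f).sum = ∑ i ∈ Finset.range n, f i := by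
    intro n f
    induction n with
    | zero => rfl
    | succ n ih =>
      rw [List.range_succ, List.map_append, List.sum_append, ih, Finset.sum_range_succ]
      simp
  rw [← hf, fin_eq, vs_eq, e]
  apply Finset.sum_congr rfl
  intro v hv
  rw [Finset.mem_range] at hv
  exact (fin1_eq (by omega) (sumU_rel' t1_ok hG)).symm
end EM

namespace EM
/-! ### Lists as halves of labelings -/
def Chr (Φ : ℕ → Finset (List ℕ)) (P : ℕ → List ℕ → Prop) : Prop :=
  ∀ v l, v ≤ 24 → (l ∈ Φ v ↔ ∃ l', l = v :: l' ∧ l.Nodup ∧ (∀ a ∈ l', a ≤ 24) ∧ P v l')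

theorem mem_Uf {tst : ℕ → ℕ → Bool} (htst : TstOk tst) {K : ℕ} (hK : 24 ≤ K)
    {Φ : ℕ → Finset (List ℕ)} {P : ℕ → List ℕ → Prop} (h : Chr Φ P) {v : ℕ} (hv : v ≤ 24)
    {l : List ℕ} : l ∈ Uf tst (K - v) Φ ↔ l.Nodup ∧ (∀ a ∈ l, a ≤ 24) ∧
      ∃ e x l', l = e :: x :: l' ∧ v + e + x = K ∧ tst e x = true ∧ P x l' := by
  simp only [Uf, Finset.mem_biUnion, Finset.mem_range]
  constructor
  · rintro ⟨x, hx, hl⟩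
    unfold Ux at hl
    split_ifs at hl with hc
    · obtain ⟨l', h1, h2, rfl⟩ := mem_ext.1 hl
      obtain ⟨l2, rfl, h4, h5, h6⟩ := (h x l' (by omega)).1 h1
      refine ⟨List.nodup_cons.2 ⟨h2, h4⟩, ?_, _, x, l2, rfl, by omega, hc.2, h6⟩
      intro a ha
      rw [List.mem_cons, List.mem_cons] at ha
      rcases ha with rfl | rfl | ha
      · exact htst _ _ hx hc.2
      · omega
      · exact h5 a ha
    · simp at hl
  · rintro ⟨h1, h2, e, x, l', rfl, h3, h4, h5⟩
    have hx : x ≤ 24 := h2 x (by simp)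
    refine ⟨x, by omega, ?_⟩
    have he : K - v - x = e := by omega
    unfold Ux
    rw [he, if_pos ⟨by omega, h4⟩]
    rw [List.nodup_cons] at h1
    exact mem_ext.2 ⟨x :: l', (h x _ hx).2 ⟨l', rfl, h1.2, fun a ha => h2 a (by simp [ha]), h5⟩,
      h1.1, rfl⟩

def nP (tst : ℕ → ℕ → Bool) (K : ℕ) (P : ℕ → List ℕ → Prop) (v : ℕ) (l : List ℕ) : Prop :=
  ∃ e x l', l = e :: x :: l' ∧ v + e + x = K ∧ tst e x = true ∧ P x l'

theorem Chr_nxt {tst : ℕ → ℕ → Bool} (htst : TstOk tst) {K : ℕ} (hK : 24 ≤ K)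
    {Φ : ℕ → Finset (List ℕ)} {P : ℕ → List ℕ → Prop} (h : Chr Φ P) :
    Chr (nxt tst K Φ) (nP tst K P) := by
  intro v l hv
  unfold nxt
  rw [mem_ext]
  constructor
  · rintro ⟨l', h1, h2, rfl⟩
    obtain ⟨h3, h4, h5⟩ := (mem_Uf htst hK h hv).1 h1
    exact ⟨l', rfl, List.nodup_cons.2 ⟨h2, h3⟩, h4, h5⟩
  · rintro ⟨l', rfl, h2, h3, h4⟩
    rw [List.nodup_cons] at h2
    exact ⟨l', (mem_Uf htst hK h hv).2 ⟨h2.2, h3, h4⟩, h2.1, rfl⟩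

theorem Chr0 : Chr Φ0 (fun _ l => l = []) := by
  intro v l hv
  unfold Φ0
  rw [mem_ext]
  constructor
  · rintro ⟨l', h1, h2, rfl⟩
    rw [Finset.mem_singleton] at h1
    subst h1
    exact ⟨[], rfl, by simp, by simp, rfl⟩
  · rintro ⟨l', rfl, h2, h3, rfl⟩
    exact ⟨[], by simp, by simp, rfl⟩

theorem mem_U5 {K : ℕ} (hK : 24 ≤ K) {v : ℕ} (hv : v ≤ 24) {l : List ℕ} :
    l ∈ Uf t1 (K - v) (Φ5 K) ↔ l.Nodup ∧ (∀ a ∈ l, a ≤ 24) ∧ ∃ e5 x5 e4 x4 e3 x3 e2 x2 e1 x1 e0 x0,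
      l = [e5, x5, e4, x4, e3, x3, e2, x2, e1, x1, e0, x0] ∧ v + e5 + x5 = K ∧
      x5 + e4 + x4 = K ∧ x4 + e3 + x3 = K ∧ x3 + e2 + x2 = K ∧ x2 + e1 + x1 = K ∧
      x1 + e0 + x0 = K ∧ e0 < x0 := by
  have hc := Chr_nxt t1_ok hK (Chr_nxt t1_ok hK (Chr_nxt t1_ok hK (Chr_nxt t1_ok hK
    (Chr_nxt t0_ok hK Chr0))))
  unfold Φ5
  rw [mem_Uf t1_ok hK hc hv]
  constructor
  · rintro ⟨h1, h2, e5, x5, _, rfl, a5, _, e4, x4, _, rfl, a4, _, e3, x3, _, rfl, a3, _,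
      e2, x2, _, rfl, a2, _, e1, x1, _, rfl, a1, _, e0, x0, _, rfl, a0, b0, rfl⟩
    exact ⟨h1, h2, e5, x5, e4, x4, e3, x3, e2, x2, e1, x1, e0, x0, rfl, a5, a4, a3, a2, a1, a0,
      Nat.le_of_ble_eq_true b0⟩
  · rintro ⟨h1, h2, e5, x5, e4, x4, e3, x3, e2, x2, e1, x1, e0, x0, rfl, a5, a4, a3, a2, a1, a0, b0⟩
    have ht : ∀ e x, e ≤ 24 → t1 e x = true := fun e x h => Nat.ble_eq_true_of_le h
    have hb : t0 e0 x0 = true := Nat.ble_eq_true_of_le b0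
    refine ⟨h1, h2, e5, x5, _, rfl, a5, ht _ _ (h2 _ (by simp)), e4, x4, _, rfl, a4,
      ht _ _ (h2 _ (by simp)), e3, x3, _, rfl, a3, ht _ _ (h2 _ (by simp)),
      e2, x2, _, rfl, a2, ht _ _ (h2 _ (by simp)), e1, x1, _, rfl, a1, ht _ _ (h2 _ (by simp)),
      e0, x0, _, rfl, a0, hb, rfl⟩

/-! ### Labelings -/
abbrev P25 := Equiv.Perm (Fin 25)
def Tri (K : ℕ) (σ : P25) : Prop := ∀ i : Fin 12,
  (σ ⟨2 * i.1, by omega⟩).val + (σ ⟨2 * i.1 + 1, by omega⟩).val +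
    (σ ⟨2 * i.1 + 2, by omega⟩).val = K
instance (K : ℕ) (σ : P25) : Decidable (Tri K σ) := by unfold Tri; infer_instance
def X (K : ℕ) : Finset P25 := Finset.univ.filter (fun σ => Tri K σ)
def X' (K : ℕ) : Finset P25 := Finset.univ.filter (fun σ => Tri K σ ∧
  (σ 1).val < (σ 0).val ∧ (σ 23).val < (σ 24).val)

def lft (σ : P25) : List ℕ := ([11, 10, 9, 8, 7, 6, 5, 4, 3, 2, 1, 0] : List (Fin 25)).map
  (fun i => (σ i).val)
def rgt (σ : P25) : List ℕ := ([13, 14, 15, 16, 17, 18, 19, 20, 21, 22, 23, 24] : List (Fin 25)).map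
  (fun i => (σ i).val)

theorem X'_mem (K : ℕ) (hK : 24 ≤ K) (σ : P25) (h : σ ∈ X' K) :
    (lft σ, rgt σ) ∈ PP (σ 12).val (Uf t1 (K - (σ 12).val) (Φ5 K)) := by
  rw [X', Finset.mem_filter] at h
  obtain ⟨_, h, g0, g24⟩ := h
  have hinj : Function.Injective (fun i : Fin 25 => (σ i).val) :=
    fun a b hab => σ.injective (Fin.ext hab)
  have nd : ∀ l : List (Fin 25), l.Nodup → (l.map (fun i => (σ i).val)).Nodup :=
    fun l hl => hl.map hinj
  have le : ∀ l : List (Fin 25), ∀ a ∈ (l.map (fun i => (σ i).val)), a ≤ 24 := by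
    intro l a ha
    rw [List.mem_map] at ha
    obtain ⟨i, _, rfl⟩ := ha
    have := (σ i).isLt
    omega
  have hv : (σ 12).val ≤ 24 := by have := (σ 12).isLt; omega
  have q0 : (σ 0).val + (σ 1).val + (σ 2).val = K := h 0
  have q1 : (σ 2).val + (σ 3).val + (σ 4).val = K := h 1
  have q2 : (σ 4).val + (σ 5).val + (σ 6).val = K := h 2
  have q3 : (σ 6).val + (σ 7).val + (σ 8).val = K := h 3
  have q4 : (σ 8).val + (σ 9).val + (σ 10).val = K := h 4
  have q5 : (σ 10).val + (σ 11).val + (σ 12).val = K := h 5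
  have q6 : (σ 12).val + (σ 13).val + (σ 14).val = K := h 6
  have q7 : (σ 14).val + (σ 15).val + (σ 16).val = K := h 7
  have q8 : (σ 16).val + (σ 17).val + (σ 18).val = K := h 8
  have q9 : (σ 18).val + (σ 19).val + (σ 20).val = K := h 9
  have q10 : (σ 20).val + (σ 21).val + (σ 22).val = K := h 10
  have q11 : (σ 22).val + (σ 23).val + (σ 24).val = K := h 11
  rw [mem_PP]
  refine ⟨(mem_U5 hK hv).2 ⟨nd _ (by decide), le _, _, _, _, _, _, _, _, _, _, _, _, _, rfl, ?_, ?_, ?_, ?_, ?_, ?_, ?_⟩,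
    (mem_U5 hK hv).2 ⟨nd _ (by decide), le _, _, _, _, _, _, _, _, _, _, _, _, _, rfl, ?_, ?_, ?_, ?_, ?_, ?_, ?_⟩, ?_⟩
  all_goals first | (dsimp only; omega) | skip
  exact nd [12, 11, 10, 9, 8, 7, 6, 5, 4, 3, 2, 1, 0, 13, 14, 15, 16, 17, 18, 19, 20, 21, 22, 23, 24]
    (by decide)

theorem X'_surj (K : ℕ) (hK : 24 ≤ K) (v : ℕ) (hv : v ≤ 24) (l1 l2 : List ℕ)
    (h : (l1, l2) ∈ PP v (Uf t1 (K - v) (Φ5 K))) :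
    ∃ σ ∈ X' K, (σ 12).val = v ∧ lft σ = l1 ∧ rgt σ = l2 := by
  rw [mem_PP] at h
  obtain ⟨h1, h2, hn⟩ := h
  dsimp only at h1 h2 hn
  obtain ⟨_, le1, e5, x5, e4, x4, e3, x3, e2, x2, e1, x1, e0, x0, rfl, a5, a4, a3, a2, a1, a0, b0⟩ := (mem_U5 hK hv).1 h1
  obtain ⟨_, le2, f5, y5, f4, y4, f3, y3, f2, y2, f1, y1, f0, y0, rfl, c5, c4, c3, c2, c1, c0, d0⟩ := (mem_U5 hK hv).1 h2
  set L : List ℕ := [x0, e0, x1, e1, x2, e2, x3, e3, x4, e4, x5, e5, v, f5, y5, f4, y4, f3, y3, f2, y2, f1, y1, f0, y0] with hL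
  have ln : L.Nodup := by
    have hp : L.Perm (v :: ([e5, x5, e4, x4, e3, x3, e2, x2, e1, x1, e0, x0] ++ [f5, y5, f4, y4, f3, y3, f2, y2, f1, y1, f0, y0])) := by
      have e : L = [e5, x5, e4, x4, e3, x3, e2, x2, e1, x1, e0, x0].reverse ++ v :: [f5, y5, f4, y4, f3, y3, f2, y2, f1, y1, f0, y0] := rfl
      rw [e]
      exact List.perm_middle.trans (((List.reverse_perm _).append_right _).cons v)
    exact hp.nodup_iff.2 hn
  have lle : ∀ i : Fin 25, L.get i < 25 := by
    intro i
    have hm : L.get i ∈ L := List.get_mem _ _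
    generalize L.get i = a at hm
    have : a ∈ [x0, e0, x1, e1, x2, e2, x3, e3, x4, e4, x5, e5] ∨ a = v ∨ a ∈ [f5, y5, f4, y4, f3, y3, f2, y2, f1, y1, f0, y0] := by
      have e : L = [x0, e0, x1, e1, x2, e2, x3, e3, x4, e4, x5, e5] ++ v :: [f5, y5, f4, y4, f3, y3, f2, y2, f1, y1, f0, y0] := rfl
      rw [e] at hm
      rcases List.mem_append.1 hm with hm | hm
      · exact Or.inl hm
      · exact Or.inr (List.mem_cons.1 hm)
    rcases this with h | h | h
    · have := le1 a (by
        have := List.mem_reverse.2 h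
        exact this)
      omega
    · omega
    · have := le2 a h
      omega
  have inj : Function.Injective (fun i : Fin 25 => (⟨L.get i, lle i⟩ : Fin 25)) := by
    intro i j hij
    exact ln.injective_get (Fin.mk.inj hij)
  let σ : P25 := Equiv.ofBijective _ (Finite.injective_iff_bijective.1 inj)
  have hσ : ∀ i, (σ i).val = L.get i := fun i => rfl
  refine ⟨σ, ?_, rfl, rfl, rfl⟩
  rw [X', Finset.mem_filter]
  refine ⟨Finset.mem_univ _, ?_, b0, d0⟩
  intro i
  fin_cases i
  · show x0 + e0 + x1 = K
    omega
  · show x1 + e1 + x2 = K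
    omega
  · show x2 + e2 + x3 = K
    omega
  · show x3 + e3 + x4 = K
    omega
  · show x4 + e4 + x5 = K
    omega
  · show x5 + e5 + v = K
    omega
  · show v + f5 + y5 = K
    omega
  · show y5 + f4 + y4 = K
    omega
  · show y4 + f3 + y3 = K
    omega
  · show y3 + f2 + y2 = K
    omega
  · show y2 + f1 + y1 = K
    omega
  · show y1 + f0 + y0 = K
    omega

theorem X'_card (K : ℕ) (hK : 24 ≤ K) :
    (X' K).card = ∑ v ∈ Finset.range 25, (PP v (Uf t1 (K - v) (Φ5 K))).card := by
  rw [← Finset.card_sigma]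
  apply Finset.card_bij (fun σ _ => (⟨(σ 12).val, (lft σ, rgt σ)⟩ : Σ _ : ℕ, List ℕ × List ℕ))
  · intro σ hσ
    rw [Finset.mem_sigma]
    exact ⟨Finset.mem_range.2 (σ 12).isLt, X'_mem K hK σ hσ⟩
  · intro σ _ τ _ h
    rw [Sigma.mk.injEq] at h
    obtain ⟨h1, h2⟩ := h
    have h2 := eq_of_heq h2
    rw [Prod.mk.injEq, lft, lft, rgt, rgt, List.map_inj_left, List.map_inj_left] at h2
    apply Equiv.ext
    intro i
    have hm : ∀ i : Fin 25, i = 12 ∨ i ∈ ([11, 10, 9, 8, 7, 6, 5, 4, 3, 2, 1, 0] : List (Fin 25)) ∨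
      i ∈ ([13, 14, 15, 16, 17, 18, 19, 20, 21, 22, 23, 24] : List (Fin 25)) := by decide
    rcases hm i with rfl | hi | hi
    · exact Fin.ext h1
    · exact Fin.ext (h2.1 i hi)
    · exact Fin.ext (h2.2 i hi)
  · rintro ⟨v, l1, l2⟩ h
    rw [Finset.mem_sigma, Finset.mem_range] at h
    obtain ⟨σ, h1, rfl, rfl, rfl⟩ := X'_surj K hK v (Nat.le_of_lt_succ h.1) l1 l2 h.2
    exact ⟨σ, h1, rfl⟩
end EM

namespace EM
theorem two_card {β : Type} [DecidableEq β] (s : Finset β) (a : β → β) (ha : ∀ x, a (a x) = x)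
    (hs : ∀ x ∈ s, a x ∈ s) (p : β → Prop) [DecidablePred p] (hp : ∀ x ∈ s, (p (a x) ↔ ¬ p x)) :
    s.card = 2 * (s.filter p).card := by
  rw [← Finset.card_filter_add_card_filter_not (s := s) p, Nat.two_mul]
  congr 1
  apply Finset.card_bij (fun x _ => a x)
  · intro x hx
    rw [Finset.mem_filter] at hx ⊢
    exact ⟨hs x hx.1, (hp x hx.1).2 hx.2⟩
  · intro x _ y _ h
    rw [← ha x, ← ha y, h]
  · intro x hx
    rw [Finset.mem_filter] at hx
    refine ⟨a x, ?_, ha x⟩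
    rw [Finset.mem_filter]
    refine ⟨hs x hx.1, fun h => ?_⟩
    exact (hp x hx.1).1 h hx.2

theorem Tri_iff (K : ℕ) (σ : P25) : Tri K σ ↔
    (σ 0).val + (σ 1).val + (σ 2).val = K ∧
    (σ 2).val + (σ 3).val + (σ 4).val = K ∧
    (σ 4).val + (σ 5).val + (σ 6).val = K ∧
    (σ 6).val + (σ 7).val + (σ 8).val = K ∧
    (σ 8).val + (σ 9).val + (σ 10).val = K ∧
    (σ 10).val + (σ 11).val + (σ 12).val = K ∧
    (σ 12).val + (σ 13).val + (σ 14).val = K ∧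
    (σ 14).val + (σ 15).val + (σ 16).val = K ∧
    (σ 16).val + (σ 17).val + (σ 18).val = K ∧
    (σ 18).val + (σ 19).val + (σ 20).val = K ∧
    (σ 20).val + (σ 21).val + (σ 22).val = K ∧
    (σ 22).val + (σ 23).val + (σ 24).val = K := by
  constructor
  · intro h
    exact ⟨h 0, h 1, h 2, h 3, h 4, h 5, h 6, h 7, h 8, h 9, h 10, h 11⟩
  · rintro ⟨h0, h1, h2, h3, h4, h5, h6, h7, h8, h9, h10, h11⟩ i
    fin_cases i
    · exact h0
    · exact h1
    · exact h2
    · exact h3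
    · exact h4
    · exact h5
    · exact h6
    · exact h7
    · exact h8
    · exact h9
    · exact h10
    · exact h11

theorem val_ne (σ : P25) (i j : Fin 25) (h : i ≠ j) : (σ i).val ≠ (σ j).val :=
  fun e => h (σ.injective (Fin.ext e))

theorem X_card (K : ℕ) : (X K).card = 4 * (X' K).card := by
  have h1 : (X K).card = 2 * ((X K).filter (fun σ => (σ 1).val < (σ 0).val)).card := by
    apply two_card _ (fun σ => (Equiv.swap 0 1).trans σ)
    · intro σ
      ext i; simp
    · intro σ hσ
      simp only [X, Finset.mem_filter, Finset.mem_univ, true_and, Tri_iff] at hσ ⊢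
      obtain ⟨h0, h⟩ := hσ
      refine ⟨?_, h⟩
      show (σ 1).val + (σ 0).val + (σ 2).val = K
      omega
    · intro σ _
      have := val_ne σ 0 1 (by decide)
      show (σ 0).val < (σ 1).val ↔ ¬ (σ 1).val < (σ 0).val
      omega
  have h2 : ((X K).filter (fun σ => (σ 1).val < (σ 0).val)).card =
      2 * (((X K).filter (fun σ => (σ 1).val < (σ 0).val)).filter
        (fun σ => (σ 23).val < (σ 24).val)).card := by
    apply two_card _ (fun σ => (Equiv.swap 23 24).trans σ)
    · intro σ
      ext i; simp
    · intro σ hσ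
      simp only [X, Finset.mem_filter, Finset.mem_univ, true_and, Tri_iff] at hσ ⊢
      obtain ⟨⟨h0, h1, h2, h3, h4, h5, h6, h7, h8, h9, h10, h11⟩, h⟩ := hσ
      refine ⟨⟨h0, h1, h2, h3, h4, h5, h6, h7, h8, h9, h10, ?_⟩, h⟩
      show (σ 22).val + (σ 24).val + (σ 23).val = K
      omega
    · intro σ _
      have := val_ne σ 23 24 (by decide)
      show (σ 24).val < (σ 23).val ↔ ¬ (σ 23).val < (σ 24).val
      omega
  have h3 : ((X K).filter (fun σ => (σ 1).val < (σ 0).val)).filter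
        (fun σ => (σ 23).val < (σ 24).val) = X' K := by
    ext σ
    simp only [X, X', Finset.mem_filter, Finset.mem_univ, true_and, and_assoc]
  rw [h1, h2, h3]; ring

theorem Tri_dual (K : ℕ) (σ : P25) (h : Tri K σ) : K ≤ 72 ∧ Tri (72 - K) (σ.trans Fin.revPerm) := by
  have hr : ∀ i, ((σ.trans Fin.revPerm) i).val = 24 - (σ i).val := by
    intro i
    show (Fin.rev (σ i)).val = _
    rw [Fin.val_rev]; omega
  have hl : ∀ i, (σ i).val ≤ 24 := fun i => by have := (σ i).isLt; omega
  constructor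
  · have h0 := h 0
    have a1 := hl ⟨2 * (0 : Fin 12).1, by omega⟩
    have a2 := hl ⟨2 * (0 : Fin 12).1 + 1, by omega⟩
    have a3 := hl ⟨2 * (0 : Fin 12).1 + 2, by omega⟩
    omega
  · intro i
    have h0 := h i
    have a1 := hl ⟨2 * i.1, by omega⟩
    have a2 := hl ⟨2 * i.1 + 1, by omega⟩
    have a3 := hl ⟨2 * i.1 + 2, by omega⟩
    rw [hr, hr, hr]
    omega

theorem X_dual_le (K : ℕ) : (X K).card ≤ (X (72 - K)).card := by
  apply Finset.card_le_card_of_injOn (fun σ => σ.trans Fin.revPerm)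
  · intro σ hσ
    simp only [X, Finset.coe_filter, Finset.mem_univ, true_and, Set.mem_ofPred_eq] at hσ ⊢
    exact (Tri_dual K σ hσ).2
  · intro σ _ τ _ h
    apply Equiv.ext
    intro i
    have := congrArg (fun ρ : P25 => ρ i) h
    exact Fin.revPerm.injective this

theorem X_dual (K : ℕ) (hK : K ≤ 72) : (X K).card = (X (72 - K)).card := by
  apply le_antisymm (X_dual_le K)
  have := X_dual_le (72 - K)
  rwa [show 72 - (72 - K) = K by omega] at this

theorem sum_ge (s : Finset ℕ) : ∑ i ∈ Finset.range s.card, i ≤ ∑ i ∈ s, i := by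
  induction s using Finset.induction_on_max with
  | empty => simp
  | insert a s h ih =>
    have ha : a ∉ s := fun h' => lt_irrefl _ (h a h')
    rw [Finset.card_insert_of_notMem ha, Finset.sum_range_succ, Finset.sum_insert ha]
    have hc : s.card ≤ a := by
      have := Finset.card_le_card (s := s) (t := Finset.range a)
        (fun x hx => Finset.mem_range.2 (h x hx))
      simpa using this
    omega

theorem Tri_ge (K : ℕ) (σ : P25) (h : Tri K σ) : 30 ≤ K := by
  have hs : ∑ i : Fin 25, (σ i).val = 300 := by
    rw [Equiv.sum_comp σ (fun i => i.val)]; decide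
  have hi : 55 ≤ ∑ i ∈ ({2, 4, 6, 8, 10, 12, 14, 16, 18, 20, 22} : Finset (Fin 25)), (σ i).val := by
    have hinj : Function.Injective (fun i : Fin 25 => (σ i).val) :=
      fun a b hab => σ.injective (Fin.ext hab)
    have := sum_ge (({2, 4, 6, 8, 10, 12, 14, 16, 18, 20, 22} : Finset (Fin 25)).image
      (fun i => (σ i).val))
    rw [Finset.card_image_of_injective _ hinj, Finset.sum_image (fun a _ b _ hab => hinj hab)] at this
    refine le_trans ?_ this
    decide
  have hi2 : ∑ i ∈ ({2, 4, 6, 8, 10, 12, 14, 16, 18, 20, 22} : Finset (Fin 25)), (σ i).val =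
      (σ 2).val + ((σ 4).val + ((σ 6).val + ((σ 8).val + ((σ 10).val + ((σ 12).val + ((σ 14).val + ((σ 16).val + ((σ 18).val + ((σ 20).val + ((σ 22).val)))))))))) := by
    rfl
  have hs2 : ∑ i : Fin 25, (σ i).val = (σ 0).val + ((σ 1).val + ((σ 2).val + ((σ 3).val + ((σ 4).val + ((σ 5).val + ((σ 6).val + ((σ 7).val + ((σ 8).val + ((σ 9).val + ((σ 10).val + ((σ 11).val + ((σ 12).val + ((σ 13).val + ((σ 14).val + ((σ 15).val + ((σ 16).val + ((σ 17).val + ((σ 18).val + ((σ 19).val + ((σ 20).val + ((σ 21).val + ((σ 22).val + ((σ 23).val + ((σ 24).val)))))))))))))))))))))))) := by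
    rfl
  obtain ⟨h0, h1, h2, h3, h4, h5, h6, h7, h8, h9, h10, h11⟩ := (Tri_iff K σ).1 h
  omega

theorem Tri_le (K : ℕ) (σ : P25) (h : Tri K σ) : K ≤ 42 := by
  have h1 := Tri_dual K σ h
  have h2 := Tri_ge _ _ h1.2
  omega

open Classical in
noncomputable def Y0 : Finset P25 := Finset.univ.filter (fun σ : P25 => ∃ K, Tri K σ)
open Classical in
noncomputable def Y : Finset P25 := Finset.univ.filter (fun σ : P25 =>
  (∃ K, Tri K σ) ∧ (σ 0).val < (σ 24).val)
theorem mem_Y0 (σ : P25) : σ ∈ Y0 ↔ ∃ K, Tri K σ := by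
  classical
  unfold Y0
  rw [Finset.mem_filter]; exact and_iff_right (Finset.mem_univ _)
theorem mem_Y (σ : P25) : σ ∈ Y ↔ (∃ K, Tri K σ) ∧ (σ 0).val < (σ 24).val := by
  classical
  unfold Y
  rw [Finset.mem_filter]; exact and_iff_right (Finset.mem_univ _)
theorem mem_X (K : ℕ) (σ : P25) : σ ∈ X K ↔ Tri K σ := by
  rw [X, Finset.mem_filter]; exact and_iff_right (Finset.mem_univ _)

theorem total : Y0.card = ∑ K ∈ Finset.Icc 30 42, (X K).card := by
  have hd : ∀ K ∈ Finset.Icc 30 42, ∀ K' ∈ Finset.Icc 30 42, K ≠ K' → Disjoint (X K) (X K') := by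
    intro K _ K' _ hne
    rw [Finset.disjoint_left]
    intro σ h1 h2
    rw [mem_X] at h1 h2
    exact hne ((h1 0).symm.trans (h2 0))
  rw [← Finset.card_biUnion hd]
  refine congrArg Finset.card (Finset.ext fun σ => ?_)
  simp only [mem_X, mem_Y0, Finset.mem_biUnion, Finset.mem_Icc]
  constructor
  · rintro ⟨K, h⟩
    exact ⟨K, ⟨Tri_ge K σ h, Tri_le K σ h⟩, h⟩
  · rintro ⟨K, _, h⟩
    exact ⟨K, h⟩

theorem rev_half : Y0.card = 2 * Y.card := by
  have e : Y = Y0.filter (fun σ : P25 => (σ 0).val < (σ 24).val) := by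
    ext σ
    rw [Finset.mem_filter, mem_Y0, mem_Y]
  rw [e]
  apply two_card Y0 (fun σ : P25 => Fin.revPerm.trans σ)
  · intro σ
    ext i; simp
  · intro σ hσ
    rw [mem_Y0] at hσ ⊢
    obtain ⟨K, h⟩ := hσ
    obtain ⟨h0, h1, h2, h3, h4, h5, h6, h7, h8, h9, h10, h11⟩ := (Tri_iff K σ).1 h
    refine ⟨K, (Tri_iff _ _).2 ?_⟩
    show (σ 24).val + (σ 23).val + (σ 22).val = K ∧
    (σ 22).val + (σ 21).val + (σ 20).val = K ∧
    (σ 20).val + (σ 19).val + (σ 18).val = K ∧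
    (σ 18).val + (σ 17).val + (σ 16).val = K ∧
    (σ 16).val + (σ 15).val + (σ 14).val = K ∧
    (σ 14).val + (σ 13).val + (σ 12).val = K ∧
    (σ 12).val + (σ 11).val + (σ 10).val = K ∧
    (σ 10).val + (σ 9).val + (σ 8).val = K ∧
    (σ 8).val + (σ 7).val + (σ 6).val = K ∧
    (σ 6).val + (σ 5).val + (σ 4).val = K ∧
    (σ 4).val + (σ 3).val + (σ 2).val = K ∧
    (σ 2).val + (σ 1).val + (σ 0).val = K
    omega
  · intro σ _
    have := val_ne σ 0 24 (by decide)
    show (σ 24).val < (σ 0).val ↔ ¬ (σ 0).val < (σ 24).val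
    omega

theorem arith (N : ℕ) (x : ℕ → ℕ) (e : ∑ K ∈ Finset.Icc 30 42, x K = 2 * N)
    (d : ∀ K ≤ 72, x K = x (72 - K))
    (c36 : x 36 = 4 * 3302308) (c30 : x 30 = 4 * 28826) (c31 : x 31 = 4 * 234466)
    (c32 : x 32 = 4 * 573586) (c33 : x 33 = 4 * 1488286) (c34 : x 34 = 4 * 2207006)
    (c35 : x 35 = 4 * 3291370) : N = 37898776 := by
  have d37 : x 37 = x 35 := d 37 (by norm_num)
  have d38 : x 38 = x 34 := d 38 (by norm_num)
  have d39 : x 39 = x 33 := d 39 (by norm_num)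
  have d40 : x 40 = x 32 := d 40 (by norm_num)
  have d41 : x 41 = x 31 := d 41 (by norm_num)
  have d42 : x 42 = x 30 := d 42 (by norm_num)
  have hs : Finset.Icc 30 42 = {30, 31, 32, 33, 34, 35, 36, 37, 38, 39, 40, 41, 42} := by decide
  rw [hs] at e
  simp at e
  omega

theorem count (R : run 36 vs 3302308 = true ∧ run 30 vs 28826 = true ∧ run 31 vs 234466 = true ∧
    run 32 vs 573586 = true ∧ run 33 vs 1488286 = true ∧ run 34 vs 2207006 = true ∧
    run 35 vs 3291370 = true) : Y.card = 37898776 := by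
  have h : ∀ K tot, 24 ≤ K → run K vs tot = true → (X K).card = 4 * tot := by
    intro K tot hK hr
    rw [X_card, X'_card K hK, run_card hr]
  obtain ⟨r36, r30, r31, r32, r33, r34, r35⟩ := R
  exact arith Y.card (fun K => (X K).card) (total.symm.trans rev_half) X_dual
    (h _ _ (by norm_num) r36) (h _ _ (by norm_num) r30) (h _ _ (by norm_num) r31)
    (h _ _ (by norm_num) r32) (h _ _ (by norm_num) r33) (h _ _ (by norm_num) r34)
    (h _ _ (by norm_num) r35)
end EM

namespace EM
set_option maxHeartbeats 0 in
theorem runs : run 36 vs 3302308 = true ∧ run 30 vs 28826 = true ∧ run 31 vs 234466 = true ∧ run 32 vs 573586 = true ∧ run 33 vs 1488286 = true ∧ run 34 vs 2207006 = true ∧ run 35 vs 3291370 = true := by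
  refine ⟨?_, ?_, ?_, ?_, ?_, ?_, ?_⟩
  · decide +kernel
  · decide +kernel
  · decide +kernel
  · decide +kernel
  · decide +kernel
  · decide +kernel
  · decide +kernel
end EM

theorem EM.final (h : EM.Y.card = 37898776) : pathEMTLCountUpToRev 12 = 37898776 := by
  classical
  rw [← h]
  unfold pathEMTLCountUpToRev
  refine congrArg Finset.card (Finset.ext fun σ => ?_)
  refine Iff.trans ?_ (EM.mem_Y σ).symm
  rw [Finset.mem_filter]
  refine Iff.trans (and_iff_right (Finset.mem_univ _)) (and_congr ?_ Iff.rfl)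
  constructor
  · rintro ⟨k, hk⟩
    refine ⟨k - 3, fun i => ?_⟩
    have := hk i
    exact (Nat.sub_eq_of_eq_add (by rw [← this]; ring)).symm
  · rintro ⟨k, hk⟩
    refine ⟨k + 3, fun i => ?_⟩
    have := hk i
    rw [← this]
    ring

/-- The number of edge-magic total labelings of the path `P 12`, counted up to the
reversal symmetry of the path, is `37898776`. -/
theorem pathEMTLCountUpToRev_P12 : pathEMTLCountUpToRev 12 = 37898776 := by
  exact EM.final (EM.count EM.runs)
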